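/- arXiv:0706.1303 — 2 statements merged into one kernel-verified Lean document; each statement's English description precedes it below -/
import Mathlib

section
/- Let R > 0, let B ⊂ ℝ² be the open disk of radius R centered at the origin and S = {z ∈ ℝ² : ‖z‖ = R} its boundary circle. Let f : ℝ² → ℝ be smooth with support contained in B. For z ∈ S and t > 0, let g(z, t) = t ∫_{S¹} f(z + t s) dσ(s) denote the line integral of f over the circle of radius t centered at z. Then for every y ∈ B, f(y) = (1/(4π² R)) ∫_S ∫_0^{2R} [ (∂/∂t) ( t (∂/∂t) ( g(z, t)/t ) ) ] · log| t² − ‖y − z‖² | dt dl(z), where dl is the arclength measure on S. -/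
open MeasureTheory Metric Real

theorem mul_one_sub_mul_abs_sub_le_norm_circleMap_sub {R δ a b : ℝ} (hR : 0 ≤ R) (hδ : δ ≤ 1)
    (hab : |a - b| ≤ δ) :
    R * (1 - δ) * |a - b| ≤ ‖circleMap 0 R a - circleMap 0 R b‖ := by
  have hn : ‖((a - b : ℝ) : ℂ) * Complex.I‖ = |a - b| := by
    rw [norm_mul, Complex.norm_I, mul_one, Complex.norm_real, Real.norm_eq_abs]
  have h1 := Complex.norm_exp_sub_one_sub_id_le (hn.le.trans (hab.trans hδ))
  rw [hn] at h1
  have h2 : circleMap 0 R a - circleMap 0 R b =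
      circleMap 0 R b * (Complex.exp (((a - b : ℝ) : ℂ) * Complex.I) - 1) := by
    simp only [circleMap_zero, mul_sub, mul_one, mul_assoc, ← Complex.exp_add]
    congr 4
    push_cast
    ring
  have h3 : |a - b| * (1 - δ) ≤ ‖Complex.exp (((a - b : ℝ) : ℂ) * Complex.I) - 1‖ := by
    have := norm_sub_norm_le (((a - b : ℝ) : ℂ) * Complex.I)
      (((a - b : ℝ) : ℂ) * Complex.I - (Complex.exp (((a - b : ℝ) : ℂ) * Complex.I) - 1))
    rw [sub_sub_cancel, hn, norm_sub_rev (((a - b : ℝ) : ℂ) * Complex.I)] at this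
    nlinarith [abs_nonneg (a - b)]
  rw [h2, norm_mul, norm_circleMap_zero, abs_of_nonneg hR]
  nlinarith [mul_le_mul_of_nonneg_left h3 hR]

theorem volume_le_hausdorffMeasure_image_circleMap_of_abs_sub_le {R δ : ℝ} (hR : 0 < R)
    (hδ : δ < 1) {E : Set ℝ} (hE : ∀ a ∈ E, ∀ b ∈ E, |a - b| ≤ δ) :
    ENNReal.ofReal (R * (1 - δ)) * volume E ≤ μH[1] (circleMap 0 R '' E) := by
  have hpos : 0 < R * (1 - δ) := mul_pos hR (by linarith)
  have hanti : AntilipschitzWith (R * (1 - δ)).toNNReal⁻¹ (E.domRestrict (circleMap 0 R)) := by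
    refine AntilipschitzWith.of_le_mul_dist fun a b => ?_
    have := mul_one_sub_mul_abs_sub_le_norm_circleMap_sub hR.le hδ.le (hE a a.2 b b.2)
    rw [NNReal.coe_inv, Real.coe_toNNReal _ hpos.le, inv_mul_eq_div, le_div_iff₀ hpos, mul_comm,
      dist_eq_norm]
    simpa [Subtype.dist_eq, Real.dist_eq] using this
  have h1 := hanti.le_hausdorffMeasure_image (d := 1) zero_le_one Set.univ
  have h2 : (μH[1] : Measure E) Set.univ = volume E := by
    rw [← isometry_subtype_coe.hausdorffMeasure_image (Or.inl zero_le_one), hausdorffMeasure_real]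
    simp
  rw [h2, ENNReal.rpow_one, Set.image_univ, Set.range_domRestrict, ENNReal.coe_inv
    (by simpa using hpos)] at h1
  rw [mul_comm]
  have h3 : (ENNReal.ofReal (R * (1 - δ))) ≠ 0 := by simpa using hpos
  calc volume E * ENNReal.ofReal (R * (1 - δ))
      ≤ (ENNReal.ofReal (R * (1 - δ)))⁻¹ * μH[1] (circleMap 0 R '' E)
        * ENNReal.ofReal (R * (1 - δ)) := by gcongr; exact h1
    _ = μH[1] (circleMap 0 R '' E) := by
      rw [mul_comm, ← mul_assoc, ENNReal.mul_inv_cancel h3 ENNReal.ofReal_ne_top, one_mul]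

theorem injOn_circleMap_Ioc {R : ℝ} (hR : R ≠ 0) :
    (Set.Ioc 0 (2 * π)).InjOn (circleMap 0 R) := by
  have := injOn_circleMap_of_abs_sub_le (a := 0) (b := 2 * π) (c := 0) hR
    (by simp [abs_of_pos Real.pi_pos])
  rwa [Set.uIoc_of_le Real.two_pi_pos.le] at this

theorem hausdorffMeasure_image_circleMap {R : ℝ} (hR : 0 < R) {E : Set ℝ} (hE : MeasurableSet E)
    (hE' : E ⊆ Set.Ioc 0 (2 * π)) :
    μH[1] (circleMap 0 R '' E) = ENNReal.ofReal R * volume E := by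
  apply le_antisymm
  · have := (lipschitzWith_circleMap 0 R).hausdorffMeasure_image_le zero_le_one E
    rwa [hausdorffMeasure_real, ENNReal.rpow_one, Real.nnabs_of_nonneg hR.le] at this
  · have hfin : volume E ≠ ⊤ := ((measure_mono hE').trans_lt measure_Ioc_lt_top).ne
    have key : ∀ᶠ δ in nhdsWithin (0 : ℝ) (Set.Ioi 0),
        ENNReal.ofReal (R * (1 - δ)) * volume E ≤ μH[1] (circleMap 0 R '' E) := by
      filter_upwards [Ioo_mem_nhdsGT (zero_lt_one' ℝ)] with δ hδ
      let P : ℤ → Set ℝ := fun k => E ∩ (fun x => ⌊x / δ⌋) ⁻¹' {k}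
      have hPm : ∀ k, MeasurableSet (P k) := fun k =>
        hE.inter ((Int.measurable_floor.comp (measurable_id.div_const δ))
          (measurableSet_singleton k))
      have hPE : ⋃ k, P k = E := by ext x; simp [P]
      have hPd : Pairwise (Function.onFun Disjoint P) := fun i j hij =>
        Set.disjoint_left.2 fun x hx hx' => hij (hx.2.symm.trans hx'.2)
      have hinj := (injOn_circleMap_Ioc hR.ne').mono hE'
      have hPd' : Pairwise (Function.onFun Disjoint fun k => circleMap 0 R '' P k) := by
        intro i j hij
        refine Set.disjoint_left.2 ?_
        rintro _ ⟨x, hx, rfl⟩ ⟨x', hx', h⟩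
        have := hinj hx'.1 hx.1 h
        subst this
        exact Set.disjoint_left.1 (hPd hij) hx hx'
      rw [← hPE, Set.image_iUnion, measure_iUnion hPd hPm, measure_iUnion hPd' fun k =>
        (hPm k).image_of_continuousOn_injOn (continuous_circleMap 0 R).continuousOn
          (hinj.mono Set.inter_subset_left), ← ENNReal.tsum_mul_left]
      refine ENNReal.tsum_le_tsum fun k =>
        volume_le_hausdorffMeasure_image_circleMap_of_abs_sub_le hR hδ.2 ?_
      intro a ha b hb
      have := Int.abs_sub_lt_one_of_floor_eq_floor (ha.2.trans hb.2.symm)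
      rw [← sub_div, abs_div, abs_of_pos hδ.1, div_lt_one hδ.1] at this
      exact this.le
    have hlim : Filter.Tendsto (fun δ : ℝ => ENNReal.ofReal (R * (1 - δ)) * volume E)
        (nhdsWithin 0 (Set.Ioi 0)) (nhds (ENNReal.ofReal R * volume E)) := by
      refine ENNReal.Tendsto.mul_const ?_ (Or.inr hfin)
      have : Continuous fun δ : ℝ => ENNReal.ofReal (R * (1 - δ)) :=
        ENNReal.continuous_ofReal.comp (by fun_prop)
      simpa using (this.tendsto 0).mono_left nhdsWithin_le_nhds
    exact le_of_tendsto hlim key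

theorem setIntegral_sphere_hausdorffMeasure {R : ℝ} (hR : 0 < R) (h : ℂ → ℝ) :
    ∫ z in sphere (0 : ℂ) R, h z ∂(μH[1]) = R * ∫ θ in 0..(2 * π), h (circleMap 0 R θ) := by
  have hinj := injOn_circleMap_Ioc hR.ne'
  have hemb : MeasurableEmbedding ((Set.Ioc 0 (2 * π)).domRestrict (circleMap 0 R)) :=
    (continuous_circleMap 0 R).continuousOn.measurableEmbedding measurableSet_Ioc hinj
  have hmeas : (μH[1] : Measure ℂ).restrict (sphere 0 R) =
      (ENNReal.ofReal R • (Measure.comap Subtype.val volume)).map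
        ((Set.Ioc 0 (2 * π)).domRestrict (circleMap 0 R)) := by
    ext A hA
    rw [hemb.map_apply, Measure.smul_apply, smul_eq_mul, Measure.restrict_apply hA,
      comap_subtype_coe_apply measurableSet_Ioc,
      ← hausdorffMeasure_image_circleMap hR
        (measurableSet_Ioc.subtype_image (hemb.measurable hA)) (by simp)]
    congr 1
    have := image_circleMap_Ioc 0 R
    rw [abs_of_pos hR] at this
    rw [← this]
    ext z
    simp only [Set.mem_inter_iff, Set.mem_image, Set.mem_preimage, Subtype.exists]
    constructor
    · rintro ⟨hz, θ, hθ, rfl⟩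
      exact ⟨θ, ⟨θ, hθ, hz, rfl⟩, rfl⟩
    · rintro ⟨θ, ⟨θ', hθ, hz, rfl⟩, rfl⟩
      exact ⟨hz, θ', hθ, rfl⟩
  rw [hmeas, hemb.integral_map, integral_smul_measure, ENNReal.toReal_ofReal hR.le,
    intervalIntegral.integral_of_le Real.two_pi_pos.le, smul_eq_mul]
  congr 1
  exact integral_subtype_comap measurableSet_Ioc fun θ => h (circleMap 0 R θ)

theorem hasDerivAt_intervalIntegral_of_continuous {a b : ℝ} {F F' : ℝ → ℝ → ℝ}
    (hF : ∀ t, Continuous (F t)) (hF' : Continuous (Function.uncurry F'))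
    (hd : ∀ t θ, HasDerivAt (fun t => F t θ) (F' t θ) t) (t : ℝ) :
    HasDerivAt (fun t => ∫ θ in a..b, F t θ) (∫ θ in a..b, F' t θ) t := by
  obtain ⟨C, hC⟩ := ((isCompact_closedBall t 1).prod
    (isCompact_uIcc (a := a) (b := b))).exists_bound_of_continuousOn
    hF'.continuousOn
  refine (intervalIntegral.hasDerivAt_integral_of_dominated_loc_of_deriv_le (bound := fun _ => C)
    (closedBall_mem_nhds t one_pos) (.of_forall fun t => (hF t).aestronglyMeasurable)
    ((hF t).intervalIntegrable a b) (Continuous.aestronglyMeasurable (by fun_prop))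
    (.of_forall fun θ hθ s hs => hC (s, θ) ⟨hs, Set.uIoc_subset_uIcc hθ⟩)
    intervalIntegrable_const (.of_forall fun θ hθ s hs => hd s θ)).2

theorem laplacian_eq_fderiv_fderiv (f : ℂ → ℝ) (x : ℂ) :
    Laplacian.laplacian f x =
      fderiv ℝ (fderiv ℝ f) x 1 1 + fderiv ℝ (fderiv ℝ f) x Complex.I Complex.I := by
  rw [InnerProductSpace.laplacian_eq_iteratedFDeriv_complexPlane]
  simp [iteratedFDeriv_two_apply]

theorem laplacian_eq_fderiv_fderiv_circleMap (f : ℂ → ℝ) (x : ℂ) (θ : ℝ) :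
    Laplacian.laplacian f x =
      fderiv ℝ (fderiv ℝ f) x (circleMap 0 1 θ) (circleMap 0 1 θ) +
      fderiv ℝ (fderiv ℝ f) x (circleMap 0 1 θ * Complex.I) (circleMap 0 1 θ * Complex.I) := by
  have h : circleMap 0 1 θ = cos θ • (1 : ℂ) + sin θ • Complex.I := by
    simp [circleMap_zero, Complex.exp_mul_I]
  have h' : circleMap 0 1 θ * Complex.I = cos θ • Complex.I - sin θ • (1 : ℂ) := by
    rw [h]
    apply Complex.ext <;> simp
  rw [h', h, laplacian_eq_fderiv_fderiv]
  simp only [map_add, map_sub, map_smul, add_apply, sub_apply,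
    smul_apply, smul_eq_mul]
  linear_combination (-(fderiv ℝ (fderiv ℝ f) x 1 1) -
    fderiv ℝ (fderiv ℝ f) x Complex.I Complex.I) * sin_sq_add_cos_sq θ

theorem hasDerivAt_circleMap_radius (z : ℂ) (t θ : ℝ) :
    HasDerivAt (fun t => circleMap z t θ) (circleMap 0 1 θ) t := by
  simpa [circleMap] using
    ((Complex.ofRealCLM.hasDerivAt (x := t)).mul_const (Complex.exp (θ * Complex.I))).const_add z

theorem continuous_circleMap_uncurry (z : ℂ) :
    Continuous fun p : ℝ × ℝ => circleMap z p.1 p.2 := by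
  unfold circleMap
  fun_prop

theorem ContDiff.continuous_fderiv_fderiv {f : ℂ → ℝ} (hf : ContDiff ℝ 2 f) :
    Continuous (fderiv ℝ (fderiv ℝ f)) :=
  (hf.fderiv_right (m := 1) le_rfl).continuous_fderiv one_ne_zero

theorem ContDiff.continuous_laplacian {f : ℂ → ℝ} (hf : ContDiff ℝ 2 f) :
    Continuous (Laplacian.laplacian f) := by
  have := hf.continuous_fderiv_fderiv
  simp_rw [funext (laplacian_eq_fderiv_fderiv f)]
  fun_prop

theorem ContDiff.hasDerivAt_integral_circleMap {f : ℂ → ℝ} (hf : ContDiff ℝ 2 f)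
    (z : ℂ) (t : ℝ) :
    HasDerivAt (fun t => ∫ θ in 0..(2 * π), f (circleMap z t θ))
      (∫ θ in 0..(2 * π), fderiv ℝ f (circleMap z t θ) (circleMap 0 1 θ)) t := by
  have h1 := hf.continuous
  have h2 := hf.continuous_fderiv two_ne_zero
  have h3 := continuous_circleMap_uncurry z
  refine hasDerivAt_intervalIntegral_of_continuous (F := fun t θ => f (circleMap z t θ))
    (F' := fun t θ => fderiv ℝ f (circleMap z t θ) (circleMap 0 1 θ))
    (fun t => by fun_prop) ?_ (fun t θ => ?_) t
  · simp only [Function.uncurry_def]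
    fun_prop
  · exact (hf.differentiable two_ne_zero _).hasFDerivAt.comp_hasDerivAt t
      (hasDerivAt_circleMap_radius z t θ)

theorem ContDiff.hasDerivAt_mul_deriv_integral_circleMap {f : ℂ → ℝ} (hf : ContDiff ℝ 2 f)
    (z : ℂ) {t : ℝ} (ht : t ≠ 0) :
    HasDerivAt (fun t => t * deriv (fun t => ∫ θ in 0..(2 * π), f (circleMap z t θ)) t)
      (t * ∫ θ in 0..(2 * π), Laplacian.laplacian f (circleMap z t θ)) t := by
  have h1 := hf.continuous_fderiv two_ne_zero
  have h2 := hf.continuous_fderiv_fderiv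
  have h3 := continuous_circleMap_uncurry z
  have h4 := hf.continuous_laplacian
  have hdiff : Differentiable ℝ (fderiv ℝ f) :=
    (hf.fderiv_right (m := 1) le_rfl).differentiable one_ne_zero
  simp_rw [(hf.hasDerivAt_integral_circleMap z _).deriv]
  have key := (hasDerivAt_id' t).fun_mul (
    hasDerivAt_intervalIntegral_of_continuous (a := 0) (b := 2 * π)
    (F := fun t θ => fderiv ℝ f (circleMap z t θ) (circleMap 0 1 θ))
    (F' := fun t θ => fderiv ℝ (fderiv ℝ f) (circleMap z t θ) (circleMap 0 1 θ) (circleMap 0 1 θ))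
    (fun t => by fun_prop) (by simp only [Function.uncurry_def]; fun_prop)
    (fun t θ => by
      simpa using ((hdiff _).hasFDerivAt.comp_hasDerivAt t
        (hasDerivAt_circleMap_radius z t θ)).clm_apply (hasDerivAt_const t (circleMap 0 1 θ))) t)
  refine key.congr_deriv ?_
  have hper : ∫ θ in 0..(2 * π),
      (fderiv ℝ (fderiv ℝ f) (circleMap z t θ) (circleMap 0 t θ * Complex.I)
        (circleMap 0 t θ * Complex.I) - fderiv ℝ f (circleMap z t θ) (circleMap 0 t θ)) = 0 := by
    have hd : ∀ θ, HasDerivAt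
        (fun θ => fderiv ℝ f (circleMap z t θ) (circleMap 0 t θ * Complex.I))
        (fderiv ℝ (fderiv ℝ f) (circleMap z t θ) (circleMap 0 t θ * Complex.I)
        (circleMap 0 t θ * Complex.I) - fderiv ℝ f (circleMap z t θ) (circleMap 0 t θ)) θ := by
      intro θ
      have := ((hdiff _).hasFDerivAt.comp_hasDerivAt θ (hasDerivAt_circleMap z t θ)).clm_apply
        ((hasDerivAt_circleMap 0 t θ).mul_const Complex.I)
      rw [mul_assoc (circleMap 0 t θ) Complex.I Complex.I, Complex.I_mul_I, mul_neg_one, map_neg,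
        ← sub_eq_add_neg] at this
      exact this
    rw [intervalIntegral.integral_eq_sub_of_hasDerivAt (fun θ _ => hd θ)
      (Continuous.intervalIntegrable (by fun_prop) _ _)]
    have e1 := periodic_circleMap z t 0
    have e2 := periodic_circleMap 0 t 0
    rw [zero_add] at e1 e2
    rw [e1, e2, sub_self]
  rw [eq_comm, one_mul, ← mul_right_inj' ht, mul_add, ← sub_eq_zero]
  simp only [← intervalIntegral.integral_const_mul]
  rw [← intervalIntegral.integral_add (Continuous.intervalIntegrable (by fun_prop) _ _)
      (Continuous.intervalIntegrable (by fun_prop) _ _),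
    ← intervalIntegral.integral_sub (Continuous.intervalIntegrable (by fun_prop) _ _)
      (Continuous.intervalIntegrable (by fun_prop) _ _), ← hper]
  congr 1
  ext θ
  have hs : circleMap 0 t θ = t • circleMap 0 1 θ := by simp [circleMap_zero]
  rw [laplacian_eq_fderiv_fderiv_circleMap f _ θ, hs, smul_mul_assoc]
  simp only [map_smul, smul_apply, smul_eq_mul]
  ring

theorem integrableOn_mul_comp_circleMap_iff (h : ℂ → ℝ) (z : ℂ) :
    IntegrableOn (fun p : ℝ × ℝ => p.1 * h (circleMap z p.1 p.2))
      (Set.Ioi 0 ×ˢ Set.Ioo (-π) π) ↔ Integrable h := by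
  have h1 := integrableOn_image_iff_integrableOn_abs_det_fderiv_smul volume
    (measurableSet_Ioi.prod measurableSet_Ioo)
    (fun p _ => (hasFDerivAt_polarCoord_symm p).hasFDerivWithinAt) polarCoord.symm.injOn
    (fun p => h (z + Complex.measurableEquivRealProd.symm p))
  rw [OpenPartialHomeomorph.symm_source, polarCoord.symm_image_target_eq_source,
    integrableOn_congr_set_ae polarCoord_source_ae_eq_univ, integrableOn_univ] at h1
  have h3 := (Complex.volume_preserving_equiv_real_prod.symm).integrable_comp_emb
    Complex.measurableEquivRealProd.symm.measurableEmbedding (g := fun w => h (z + w))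
  have h4 := (measurePreserving_add_left volume z).integrable_comp_emb
    (measurableEmbedding_addLeft z) (g := h)
  rw [← h4, Function.comp_def, ← h3]
  refine Iff.trans ?_ h1.symm
  refine integrableOn_congr_fun (fun p hp => ?_) (measurableSet_Ioi.prod measurableSet_Ioo)
  rw [det_fderivPolarCoordSymm, abs_of_pos hp.1,
    Complex.measurableEquivRealProd_symm_polarCoord_symm_apply, smul_eq_mul]
  simp [circleMap, Complex.exp_mul_I]

theorem setIntegral_mul_comp_circleMap (h : ℂ → ℝ) (z : ℂ) :
    ∫ p in Set.Ioi (0 : ℝ) ×ˢ Set.Ioo (-π) π, p.1 * h (circleMap z p.1 p.2) = ∫ x, h x := by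
  rw [← integral_add_left_eq_self h z, ← Complex.integral_comp_polarCoord_symm]
  refine setIntegral_congr_fun (measurableSet_Ioi.prod measurableSet_Ioo) fun p hp => ?_
  simp [circleMap, Complex.exp_mul_I]

theorem setIntegral_Ioo_comp_circleMap (h : ℂ → ℝ) (z : ℂ) (r : ℝ) :
    ∫ θ in Set.Ioo (-π) π, h (circleMap z r θ) = ∫ θ in 0..(2 * π), h (circleMap z r θ) := by
  have := ((periodic_circleMap z r).comp h).intervalIntegral_add_eq (-π) 0
  rw [zero_add, show -π + 2 * π = π by ring,
    intervalIntegral.integral_of_le (by linarith [Real.pi_pos]),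
    integral_Ioc_eq_integral_Ioo] at this
  exact this

theorem MeasureTheory.Integrable.integrableOn_mul_integral_circleMap {h : ℂ → ℝ}
    (hh : Integrable h) (z : ℂ) :
    IntegrableOn (fun r => r * ∫ θ in 0..(2 * π), h (circleMap z r θ)) (Set.Ioi 0) := by
  have h1 := (integrableOn_mul_comp_circleMap_iff h z).2 hh
  rw [IntegrableOn, Measure.volume_eq_prod, ← Measure.prod_restrict] at h1
  have h2 := h1.integral_prod_left
  simp only [integral_const_mul, setIntegral_Ioo_comp_circleMap] at h2
  exact h2

theorem MeasureTheory.Integrable.integral_eq_integral_circleMap {h : ℂ → ℝ}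
    (hh : Integrable h) (z : ℂ) :
    ∫ x, h x = ∫ r in Set.Ioi 0, r * ∫ θ in 0..(2 * π), h (circleMap z r θ) := by
  rw [← setIntegral_mul_comp_circleMap h z, Measure.volume_eq_prod, setIntegral_prod _
    ((integrableOn_mul_comp_circleMap_iff h z).2 hh)]
  simp only [integral_const_mul, setIntegral_Ioo_comp_circleMap]

theorem continuous_mul_log_mul {R : ℝ} (hR : R ≠ 0) : Continuous fun r => r * Real.log (R * r) := by
  have : Continuous fun r => R⁻¹ * ((R * r) * Real.log (R * r)) :=
    continuous_const.mul (continuous_mul_log.comp (continuous_const_mul R))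
  convert this using 2
  field_simp

theorem comp_circleMap_eq_zero {h : ℂ → ℝ} {M r : ℝ} (hM : ∀ x, M ≤ ‖x‖ → h x = 0) (z : ℂ)
    (hr : M + ‖z‖ ≤ r) (θ : ℝ) : h (circleMap z r θ) = 0 := by
  apply hM
  have h1 := norm_sub_le (circleMap z r θ) z
  rw [circleMap_sub_center, norm_circleMap_zero] at h1
  linarith [le_abs_self r]

theorem HasCompactSupport.exists_forall_eq_zero {h : ℂ → ℝ} (hc : HasCompactSupport h) :
    ∃ M, ∀ x, M ≤ ‖x‖ → h x = 0 := by
  obtain ⟨M, hM⟩ := hc.isCompact.isBounded.subset_ball 0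
  exact ⟨M, fun x hx => image_eq_zero_of_notMem_tsupport fun h' => by
    simpa using (hx.trans_lt (mem_ball_zero_iff.1 (hM h'))).false⟩

theorem Continuous.integrable_mul_log_norm_sub {h : ℂ → ℝ} (hh : Continuous h)
    (hc : HasCompactSupport h) {R : ℝ} (hR : R ≠ 0) (y : ℂ) :
    Integrable fun x => h x * Real.log (R * ‖x - y‖) := by
  obtain ⟨M, hM⟩ := hc.exists_forall_eq_zero
  rw [← integrableOn_mul_comp_circleMap_iff _ y]
  have h1 := continuous_mul_log_mul hR
  have h2 := continuous_circleMap_uncurry y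
  have h3 : IntegrableOn (fun p : ℝ × ℝ => h (circleMap y p.1 p.2) * (p.1 * Real.log (R * p.1)))
      (Set.Ioi 0 ×ˢ Set.Ioo (-π) π) := by
    refine IntegrableOn.of_forall_sdiff_eq_zero (s := Set.Icc 0 (M + ‖y‖) ×ˢ Set.Icc (-π) π)
      (((hh.comp h2).mul (h1.comp continuous_fst)).continuousOn.integrableOn_compact
        (isCompact_Icc.prod isCompact_Icc))
      (measurableSet_Ioi.prod measurableSet_Ioo) fun p hp => ?_
    rw [comp_circleMap_eq_zero hM, zero_mul]
    by_contra hlt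
    exact hp.2 ⟨⟨hp.1.1.le, (not_le.1 hlt).le⟩, hp.1.2.1.le, hp.1.2.2.le⟩
  refine h3.congr_fun (fun p hp => ?_) (measurableSet_Ioi.prod measurableSet_Ioo)
  simp only
  rw [circleMap_sub_center, norm_circleMap_zero, abs_of_pos hp.1]
  ring

theorem HasCompactSupport.laplacian {f : ℂ → ℝ} (hc : HasCompactSupport f) :
    HasCompactSupport (Laplacian.laplacian f) := by
  refine ((hc.fderiv ℝ).fderiv ℝ).mono fun x hx hx' => hx ?_
  rw [laplacian_eq_fderiv_fderiv, hx']
  simp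

theorem ContDiff.integral_laplacian_mul_log {f : ℂ → ℝ} (hf : ContDiff ℝ 2 f)
    (hc : HasCompactSupport f) {R : ℝ} (hR : 0 < R) (y : ℂ) :
    ∫ x, Laplacian.laplacian f x * Real.log (R * ‖x - y‖) = 2 * π * f y := by
  have hint :=
    hf.continuous_laplacian.integrable_mul_log_norm_sub hc.laplacian hR.ne' y
  have hpolar : Set.EqOn (fun r => r * ∫ θ in 0..(2 * π), Laplacian.laplacian f (circleMap y r θ) *
      Real.log (R * ‖circleMap y r θ - y‖)) (fun r => (r * ∫ θ in 0..(2 * π),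
        Laplacian.laplacian f (circleMap y r θ)) * Real.log (R * r)) (Set.Ioi 0) := fun r hr => by
    simp only [circleMap_sub_center, norm_circleMap_zero, abs_of_pos hr.out,
      intervalIntegral.integral_mul_const, mul_assoc]
  rw [hint.integral_eq_integral_circleMap y, setIntegral_congr_fun measurableSet_Ioi hpolar]
  set F : ℝ → ℝ := fun r => ∫ θ in 0..(2 * π), f (circleMap y r θ) with hF
  have hFd : Differentiable ℝ F := fun r =>
    (hf.hasDerivAt_integral_circleMap y r).differentiableAt
  have hF'c : Continuous (deriv F) := by
    have h1 := hf.continuous_fderiv two_ne_zero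
    have h2 := continuous_circleMap_uncurry y
    rw [funext fun r => (hf.hasDerivAt_integral_circleMap y r).deriv]
    refine intervalIntegral.continuous_parametric_intervalIntegral_of_continuous' ?_ _ _
    simp only [Function.uncurry_def]
    fun_prop
  have hG : ∀ r ∈ Set.Ioi (0 : ℝ), HasDerivAt (fun r => deriv F r * (r * Real.log (R * r)) - F r)
      ((r * ∫ θ in 0..(2 * π), Laplacian.laplacian f (circleMap y r θ)) * Real.log (R * r)) r := by
    intro r hr
    have hlog : HasDerivAt (fun r => Real.log (R * r)) (R / (R * r)) r := by
      simpa using ((hasDerivAt_id r).const_mul R).log (mul_pos hR hr).ne'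
    have := ((hf.hasDerivAt_mul_deriv_integral_circleMap y hr.out.ne').fun_mul hlog).fun_sub
      (hFd r).hasDerivAt
    have e : (fun r => deriv F r * (r * Real.log (R * r)) - F r) =
        fun r => r * deriv F r * Real.log (R * r) - F r := by
      ext r; ring
    rw [e]
    refine this.congr_deriv ?_
    have hr' := hr.out.ne'
    field_simp
    ring
  have hGc : Continuous fun r => deriv F r * (r * Real.log (R * r)) - F r :=
    (hF'c.mul (continuous_mul_log_mul hR.ne')).sub hFd.continuous
  obtain ⟨M, hM⟩ := hc.exists_forall_eq_zero
  have hF0 : F =ᶠ[Filter.atTop] 0 := by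
    filter_upwards [Filter.eventually_ge_atTop (M + ‖y‖)] with r hr
    simp [hF, comp_circleMap_eq_zero hM y hr]
  have hlim : Filter.Tendsto (fun r => deriv F r * (r * Real.log (R * r)) - F r) Filter.atTop
      (nhds 0) := by
    refine tendsto_const_nhds.congr' ?_
    filter_upwards [Filter.eventually_gt_atTop (M + ‖y‖)] with r hr
    have : F =ᶠ[nhds r] fun _ => 0 := by
      filter_upwards [Ioi_mem_nhds hr] with s hs
      simp [hF, comp_circleMap_eq_zero hM y hs.out.le]
    rw [this.deriv_eq, this.eq_of_nhds]
    simp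
  rw [integral_Ioi_of_hasDerivAt_of_tendsto hGc.continuousWithinAt hG
    ((hint.integrableOn_mul_integral_circleMap y).congr_fun hpolar measurableSet_Ioi) hlim]
  simp [hF]

theorem Complex.norm_sq_sub_norm_sq_sub_eq {x y p : ℂ} :
    ‖x - p‖ ^ 2 - ‖y - p‖ ^ 2 =
      ‖x‖ ^ 2 - ‖y‖ ^ 2 - 2 * (p * (starRingEnd ℂ) (x - y)).re := by
  simp only [Complex.sq_norm, Complex.normSq_apply, Complex.sub_re, Complex.sub_im, Complex.mul_re,
    Complex.conj_re, Complex.conj_im, map_sub]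
  ring

theorem two_mul_abs_re_sub_eq_norm_mul_norm {v : ℂ} (hv : ‖v‖ = 1) {c s : ℝ}
    (hcs : c ^ 2 + s ^ 2 = 1) :
    2 * |v.re - c| = ‖v - (c + s * Complex.I)‖ * ‖v - (c - s * Complex.I)‖ := by
  have hv2 : v.re * v.re + v.im * v.im = 1 := by
    rw [← Complex.normSq_apply, ← Complex.sq_norm, hv, one_pow]
  rw [← sq_eq_sq₀ (by positivity) (by positivity)]
  simp only [mul_pow, sq_abs, Complex.sq_norm, Complex.normSq_apply]
  simp
  have e : v.im * v.im = 1 - v.re * v.re := by linarith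
  have e' : s ^ 2 = 1 - c ^ 2 := by linarith
  have e1 : (v.re - c) * (v.re - c) + (v.im - s) * (v.im - s) =
      2 - 2 * v.re * c - 2 * v.im * s := by
    linear_combination hv2 + hcs
  have e2 : (v.re - c) * (v.re - c) + (v.im + s) * (v.im + s) =
      2 - 2 * v.re * c + 2 * v.im * s := by
    linear_combination hv2 + hcs
  rw [e1, e2]
  linear_combination 4 * s ^ 2 * e + 4 * (1 - v.re ^ 2) * e'

theorem exists_abs_norm_sq_sub_norm_sq_circleMap_eq {R : ℝ} (hR : 0 < R) {x y : ℂ}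
    (hx : ‖x‖ ≤ R) (hy : ‖y‖ ≤ R) (hxy : x ≠ y) :
    ∃ a b : ℂ, ‖a‖ = 1 ∧ ‖b‖ = 1 ∧ ∀ θ,
      |‖x - circleMap 0 R θ‖ ^ 2 - ‖y - circleMap 0 R θ‖ ^ 2| =
        R * ‖x - y‖ * (‖circleMap 0 1 θ - a‖ * ‖circleMap 0 1 θ - b‖) := by
  have hd : 0 < ‖x - y‖ := norm_pos_iff.2 (sub_ne_zero.2 hxy)
  set u : ℂ := (x - y) / ‖x - y‖ with hu
  have hu1 : ‖u‖ = 1 := by simp [hu, hd.ne']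
  set c : ℝ := (‖x‖ ^ 2 - ‖y‖ ^ 2) / (2 * R * ‖x - y‖) with hc
  have hc1 : c ^ 2 ≤ 1 := by
    rw [sq_le_one_iff_abs_le_one, hc, abs_div, abs_of_pos (show 0 < 2 * R * ‖x - y‖ by positivity),
      div_le_one (by positivity), sq_sub_sq, abs_mul, abs_of_nonneg (by positivity)]
    gcongr
    · linarith
    · exact abs_norm_sub_norm_le x y
  have hcs : c ^ 2 + √(1 - c ^ 2) ^ 2 = 1 := by rw [Real.sq_sqrt (by linarith)]; ring
  have hcs' : c ^ 2 + (-√(1 - c ^ 2)) ^ 2 = 1 := by rw [neg_sq, hcs]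
  have hunit : ∀ s : ℝ, c ^ 2 + s ^ 2 = 1 → ‖u * (c + s * Complex.I)‖ = 1 := fun s hs => by
    rw [norm_mul, hu1, one_mul, ← sq_eq_sq₀ (norm_nonneg _) zero_le_one, Complex.sq_norm,
      Complex.normSq_apply]
    simp
    linarith
  refine ⟨u * (c + √(1 - c ^ 2) * Complex.I), u * (c - √(1 - c ^ 2) * Complex.I),
    hunit _ hcs, by simpa [sub_eq_add_neg] using hunit _ hcs', fun θ => ?_⟩
  set w := circleMap 0 1 θ with hw
  have hw1 : ‖w‖ = 1 := by simp [hw]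
  set v := w * (starRingEnd ℂ) u with hv
  have huu : u * (starRingEnd ℂ) u = 1 := by
    rw [Complex.mul_conj, ← Complex.sq_norm, hu1]; simp
  have hv1 : ‖v‖ = 1 := by simp [hv, hw1, hu1]
  have hwv : w = u * v := by rw [hv, mul_left_comm, huu, mul_one]
  have hre : (circleMap 0 R θ * (starRingEnd ℂ) (x - y)).re = R * ‖x - y‖ * v.re := by
    have e1 : circleMap 0 R θ = R * w := by simp [hw, circleMap_zero]
    have e2 : x - y = ‖x - y‖ * u := by
      rw [hu, mul_div_cancel₀]; exact_mod_cast hd.ne'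
    rw [e1, e2, map_mul, Complex.conj_ofReal,
      show (R : ℂ) * w * (‖x - y‖ * (starRingEnd ℂ) u) = ((R * ‖x - y‖ : ℝ) : ℂ) * v by
        rw [hv]; push_cast; ring, Complex.re_ofReal_mul, ← e2]
  rw [Complex.norm_sq_sub_norm_sq_sub_eq, hre, hwv, ← mul_sub, ← mul_sub, norm_mul, norm_mul, hu1,
    one_mul, one_mul, ← two_mul_abs_re_sub_eq_norm_mul_norm hv1 hcs,
    show ‖x‖ ^ 2 - ‖y‖ ^ 2 = 2 * R * ‖x - y‖ * c by rw [hc]; field_simp,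
    show 2 * R * ‖x - y‖ * c - 2 * (R * ‖x - y‖ * v.re) = -(R * ‖x - y‖ * (2 * (v.re - c))) by ring,
    abs_neg, abs_mul, abs_of_pos (mul_pos hR hd), abs_mul, abs_two]

theorem intervalIntegrable_log_norm_circleMap_sub (a : ℂ) :
    IntervalIntegrable (fun θ => Real.log ‖circleMap 0 1 θ - a‖) volume 0 (2 * π) :=
  circleIntegrable_log_norm_sub_const (c := 0) (a := a) 1

theorem integral_log_norm_circleMap_sub {a : ℂ} (ha : ‖a‖ = 1) :
    ∫ θ in 0..(2 * π), Real.log ‖circleMap 0 1 θ - a‖ = 0 := by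
  have := circleAverage_log_norm_sub_const₁ ha
  rw [circleAverage_def, smul_eq_mul, mul_eq_zero] at this
  exact this.resolve_left (by positivity)

theorem abs_log_le_sub_log {t : ℝ} (ht : 0 ≤ t) (ht2 : t ≤ 2) :
    |Real.log t| ≤ 2 * Real.log 2 - Real.log t := by
  have h2 := Real.log_pos one_lt_two
  rcases ht.eq_or_lt with rfl | ht
  · simp [h2.le]
  · have := Real.log_le_log ht ht2
    rw [abs_le]
    constructor <;> linarith

theorem integral_abs_log_norm_circleMap_sub_le {a : ℂ} (ha : ‖a‖ = 1) :
    ∫ θ in 0..(2 * π), |Real.log ‖circleMap 0 1 θ - a‖| ≤ 4 * π * Real.log 2 := by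
  have h := intervalIntegrable_log_norm_circleMap_sub a
  calc ∫ θ in 0..(2 * π), |Real.log ‖circleMap 0 1 θ - a‖|
      ≤ ∫ θ in 0..(2 * π), (2 * Real.log 2 - Real.log ‖circleMap 0 1 θ - a‖) := by
        refine intervalIntegral.integral_mono_on Real.two_pi_pos.le h.abs
          (intervalIntegrable_const.sub h) fun θ _ => abs_log_le_sub_log (norm_nonneg _) ?_
        refine (norm_sub_le _ _).trans ?_
        rw [ha, norm_circleMap_zero, abs_one]
        norm_num
    _ = 4 * π * Real.log 2 := by
        rw [intervalIntegral.integral_sub intervalIntegrable_const h,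
          integral_log_norm_circleMap_sub ha, intervalIntegral.integral_const]
        simp only [smul_eq_mul]
        ring

theorem ae_log_mul_norm_circleMap_sub_eq {k : ℝ} (hk : 0 < k) (a b : ℂ) :
    ∀ᵐ θ : ℝ, Real.log (k * (‖circleMap 0 1 θ - a‖ * ‖circleMap 0 1 θ - b‖)) =
      Real.log k + (Real.log ‖circleMap 0 1 θ - a‖ + Real.log ‖circleMap 0 1 θ - b‖) := by
  have hcount := ((Set.countable_singleton a).insert b).preimage_circleMap 0 one_ne_zero
  filter_upwards [hcount.ae_notMem volume] with θ hθ
  simp only [Set.mem_preimage, Set.mem_insert_iff, Set.mem_singleton_iff, not_or] at hθ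
  have ha : ‖circleMap 0 1 θ - a‖ ≠ 0 := norm_ne_zero_iff.2 (sub_ne_zero.2 hθ.2)
  have hb : ‖circleMap 0 1 θ - b‖ ≠ 0 := norm_ne_zero_iff.2 (sub_ne_zero.2 hθ.1)
  rw [Real.log_mul hk.ne' (mul_ne_zero ha hb), Real.log_mul ha hb]

theorem exists_ae_log_abs_norm_sq_sub_norm_sq_circleMap_eq {R : ℝ} (hR : 0 < R) {x y : ℂ}
    (hx : ‖x‖ ≤ R) (hy : ‖y‖ ≤ R) (hxy : x ≠ y) :
    ∃ a b : ℂ, ‖a‖ = 1 ∧ ‖b‖ = 1 ∧ ∀ᵐ θ : ℝ,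
      Real.log |‖x - circleMap 0 R θ‖ ^ 2 - ‖y - circleMap 0 R θ‖ ^ 2| =
        Real.log (R * ‖x - y‖) +
          (Real.log ‖circleMap 0 1 θ - a‖ + Real.log ‖circleMap 0 1 θ - b‖) := by
  obtain ⟨a, b, ha, hb, h⟩ := exists_abs_norm_sq_sub_norm_sq_circleMap_eq hR hx hy hxy
  simp only [h]
  exact ⟨a, b, ha, hb, ae_log_mul_norm_circleMap_sub_eq
    (mul_pos hR (norm_pos_iff.2 (sub_ne_zero.2 hxy))) a b⟩

theorem intervalIntegrable_log_abs_norm_sq_sub_norm_sq_circleMap {R : ℝ} (hR : 0 < R) {x y : ℂ}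
    (hx : ‖x‖ ≤ R) (hy : ‖y‖ ≤ R) (hxy : x ≠ y) :
    IntervalIntegrable (fun θ =>
      Real.log |‖x - circleMap 0 R θ‖ ^ 2 - ‖y - circleMap 0 R θ‖ ^ 2|) volume 0 (2 * π) := by
  obtain ⟨a, b, -, -, h⟩ := exists_ae_log_abs_norm_sq_sub_norm_sq_circleMap_eq hR hx hy hxy
  have hc : IntervalIntegrable (fun _ : ℝ => Real.log (R * ‖x - y‖)) volume 0 (2 * π) :=
    intervalIntegrable_const
  refine (hc.add ((intervalIntegrable_log_norm_circleMap_sub a).add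
    (intervalIntegrable_log_norm_circleMap_sub b))).congr_ae (ae_restrict_of_ae ?_)
  filter_upwards [h] with θ hθ using hθ.symm

theorem integral_log_abs_norm_sq_sub_norm_sq_circleMap {R : ℝ} (hR : 0 < R) {x y : ℂ}
    (hx : ‖x‖ ≤ R) (hy : ‖y‖ ≤ R) (hxy : x ≠ y) :
    ∫ θ in 0..(2 * π), Real.log |‖x - circleMap 0 R θ‖ ^ 2 - ‖y - circleMap 0 R θ‖ ^ 2| =
      2 * π * Real.log (R * ‖x - y‖) := by
  obtain ⟨a, b, ha, hb, h⟩ := exists_ae_log_abs_norm_sq_sub_norm_sq_circleMap_eq hR hx hy hxy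
  have h1 := intervalIntegrable_log_norm_circleMap_sub a
  have h2 := intervalIntegrable_log_norm_circleMap_sub b
  rw [intervalIntegral.integral_congr_ae (h.mono fun θ hθ _ => hθ),
    intervalIntegral.integral_add intervalIntegrable_const (h1.add h2),
    intervalIntegral.integral_add h1 h2, integral_log_norm_circleMap_sub ha,
    integral_log_norm_circleMap_sub hb, intervalIntegral.integral_const]
  simp

theorem integral_abs_log_abs_norm_sq_sub_norm_sq_circleMap_le {R : ℝ} (hR : 0 < R) {x y : ℂ}
    (hx : ‖x‖ ≤ R) (hy : ‖y‖ ≤ R) (hxy : x ≠ y) :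
    ∫ θ in 0..(2 * π), |Real.log (|‖x - circleMap 0 R θ‖ ^ 2 - ‖y - circleMap 0 R θ‖ ^ 2|)| ≤
      2 * π * |Real.log (R * ‖x - y‖)| + 8 * π * Real.log 2 := by
  obtain ⟨a, b, ha, hb, h⟩ := exists_ae_log_abs_norm_sq_sub_norm_sq_circleMap_eq hR hx hy hxy
  have h1 := (intervalIntegrable_log_norm_circleMap_sub a).abs
  have h2 := (intervalIntegrable_log_norm_circleMap_sub b).abs
  have hc : IntervalIntegrable (fun _ : ℝ => |Real.log (R * ‖x - y‖)|) volume 0 (2 * π) :=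
    intervalIntegrable_const
  calc _ ≤ ∫ θ in 0..(2 * π), (|Real.log (R * ‖x - y‖)| +
          (|Real.log ‖circleMap 0 1 θ - a‖| + |Real.log ‖circleMap 0 1 θ - b‖|)) := by
        refine intervalIntegral.integral_mono_ae Real.two_pi_pos.le
          (intervalIntegrable_log_abs_norm_sq_sub_norm_sq_circleMap hR hx hy hxy).abs
          (hc.add (h1.add h2)) ?_
        filter_upwards [h] with θ hθ
        rw [hθ]
        exact (abs_add_le _ _).trans (by gcongr; exact abs_add_le _ _)
    _ ≤ _ := by
        rw [intervalIntegral.integral_add hc (h1.add h2), intervalIntegral.integral_add h1 h2,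
          intervalIntegral.integral_const, smul_eq_mul]
        linarith [integral_abs_log_norm_circleMap_sub_le ha,
          integral_abs_log_norm_circleMap_sub_le hb]

theorem Continuous.integrable_mul_log_abs_norm_sq_sub_norm_sq_circleMap {h : ℂ → ℝ}
    (hh : Continuous h) {R : ℝ} (hR : 0 < R) (hs : tsupport h ⊆ ball 0 R) {y : ℂ} (hy : ‖y‖ ≤ R) :
    Integrable (fun p : ℂ × ℝ =>
      h p.1 * Real.log |‖p.1 - circleMap 0 R p.2‖ ^ 2 - ‖y - circleMap 0 R p.2‖ ^ 2|)
      (volume.prod (volume.restrict (Set.Ioc 0 (2 * π)))) := by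
  have hc : HasCompactSupport h := HasCompactSupport.of_support_subset_isCompact
    (isCompact_closedBall (0 : ℂ) R) ((subset_tsupport h).trans (hs.trans ball_subset_closedBall))
  have h0 : ∀ x, R < ‖x‖ → h x = 0 := fun x hx => image_eq_zero_of_notMem_tsupport fun h' =>
    hx.not_gt (mem_ball_zero_iff.1 (hs h'))
  have hne : ∀ᵐ x : ℂ, x ≠ y := by simp [ae_iff]
  have hmeas : Measurable fun p : ℂ × ℝ =>
      h p.1 * Real.log |‖p.1 - circleMap 0 R p.2‖ ^ 2 - ‖y - circleMap 0 R p.2‖ ^ 2| := by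
    have := hh.measurable
    have h2 := (continuous_circleMap 0 R).measurable
    fun_prop
  refine (integrable_prod_iff hmeas.aestronglyMeasurable).2 ⟨?_, ?_⟩
  · filter_upwards [hne] with x hx
    by_cases hxR : ‖x‖ ≤ R
    · exact ((intervalIntegrable_iff_integrableOn_Ioc_of_le Real.two_pi_pos.le).1
        (intervalIntegrable_log_abs_norm_sq_sub_norm_sq_circleMap hR hxR hy hx)).const_mul _
    · simp [h0 x (not_le.1 hxR)]
  · have hbound : Integrable fun x =>
        2 * π * |h x * Real.log (R * ‖x - y‖)| + 8 * π * Real.log 2 * |h x| :=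
      ((hh.integrable_mul_log_norm_sub hc hR.ne' y).abs.const_mul _).add
        ((hh.integrable_of_hasCompactSupport hc).abs.const_mul _)
    refine hbound.mono hmeas.aestronglyMeasurable.norm.integral_prod_right' ?_
    filter_upwards [hne] with x hx
    by_cases hxR : ‖x‖ ≤ R
    · have hle := integral_abs_log_abs_norm_sq_sub_norm_sq_circleMap_le hR hxR hy hx
      rw [intervalIntegral.integral_of_le Real.two_pi_pos.le] at hle
      simp only [norm_mul, integral_const_mul, Real.norm_eq_abs, abs_abs]
      rw [abs_of_nonneg (integral_nonneg fun _ => abs_nonneg _)]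
      refine (mul_le_mul_of_nonneg_left hle (abs_nonneg _)).trans
        ((le_of_eq ?_).trans (le_abs_self _))
      rw [abs_mul]
      ring
    · simp [h0 x (not_le.1 hxR)]

theorem ContDiff.eq_integral_circleMap_log {f : ℂ → ℝ} (hf : ContDiff ℝ 2 f) {R : ℝ} (hR : 0 < R)
    (hs : tsupport f ⊆ ball 0 R) {y : ℂ} (hy : ‖y‖ ≤ R) :
    4 * π ^ 2 * f y = ∫ θ in 0..(2 * π), ∫ t in 0..(2 * R),
      (t * ∫ φ in 0..(2 * π), Laplacian.laplacian f (circleMap (circleMap 0 R θ) t φ)) *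
        Real.log |t ^ 2 - ‖y - circleMap 0 R θ‖ ^ 2| := by
  have hc : HasCompactSupport f := HasCompactSupport.of_support_subset_isCompact
    (isCompact_closedBall (0 : ℂ) R) ((subset_tsupport f).trans (hs.trans ball_subset_closedBall))
  have hs' : tsupport (Laplacian.laplacian f) ⊆ ball 0 R := by
    refine (closure_minimal (fun x hx => ?_) (isClosed_tsupport f)).trans hs
    by_contra hx'
    apply hx
    rw [laplacian_eq_fderiv_fderiv, image_eq_zero_of_notMem_tsupport (f := fderiv ℝ (fderiv ℝ f))
      fun h => hx' (tsupport_fderiv_subset ℝ (tsupport_fderiv_subset ℝ h))]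
    simp
  have h0 : ∀ x, R ≤ ‖x‖ → Laplacian.laplacian f x = 0 := fun x hx =>
    image_eq_zero_of_notMem_tsupport fun h' => hx.not_gt (mem_ball_zero_iff.1 (hs' h'))
  have hint :=
    hf.continuous_laplacian.integrable_mul_log_abs_norm_sq_sub_norm_sq_circleMap hR hs' hy
  have hne : ∀ᵐ x : ℂ, x ≠ y := by simp [ae_iff]
  calc 4 * π ^ 2 * f y
      = 2 * π * ∫ x, Laplacian.laplacian f x * Real.log (R * ‖x - y‖) := by
        rw [hf.integral_laplacian_mul_log hc hR]
        ring
    _ = ∫ x, ∫ θ in Set.Ioc 0 (2 * π), Laplacian.laplacian f x *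
          Real.log |‖x - circleMap 0 R θ‖ ^ 2 - ‖y - circleMap 0 R θ‖ ^ 2| := by
        rw [← integral_const_mul]
        refine integral_congr_ae ?_
        filter_upwards [hne] with x hx
        rw [integral_const_mul]
        rcases le_or_gt ‖x‖ R with hxR | hxR
        · rw [← intervalIntegral.integral_of_le Real.two_pi_pos.le,
            integral_log_abs_norm_sq_sub_norm_sq_circleMap hR hxR hy hx]
          ring
        · simp [h0 x hxR.le]
    _ = ∫ θ in Set.Ioc 0 (2 * π), ∫ x, Laplacian.laplacian f x *
          Real.log |‖x - circleMap 0 R θ‖ ^ 2 - ‖y - circleMap 0 R θ‖ ^ 2| :=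
        integral_integral_swap hint
    _ = _ := by
        rw [intervalIntegral.integral_of_le Real.two_pi_pos.le]
        refine integral_congr_ae ?_
        filter_upwards [hint.prod_left_ae] with θ hθ
        rw [hθ.integral_eq_integral_circleMap (circleMap 0 R θ),
          intervalIntegral.integral_of_le (by positivity)]
        symm
        refine (setIntegral_congr_fun measurableSet_Ioc fun t ht => ?_).trans
          (setIntegral_eq_of_subset_of_forall_sdiff_eq_zero measurableSet_Ioi
            Set.Ioc_subset_Ioi_self fun t ht => ?_).symm
        · simp only [circleMap_sub_center, norm_circleMap_zero, abs_of_pos ht.1,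
            intervalIntegral.integral_mul_const, mul_assoc]
        · have ht' : R + ‖circleMap 0 R θ‖ ≤ t := by
            rw [norm_circleMap_zero, abs_of_pos hR]
            by_contra hlt
            exact ht.2 ⟨ht.1, by linarith⟩
          simp [comp_circleMap_eq_zero h0 _ ht']

theorem LinearIsometryEquiv.setIntegral_sphere_hausdorffMeasure
    {E F : Type*} [NormedAddCommGroup E] [NormedSpace ℝ E] [MeasurableSpace E] [BorelSpace E]
    [NormedAddCommGroup F] [NormedSpace ℝ F] [MeasurableSpace F] [BorelSpace F]
    (L : E ≃ₗᵢ[ℝ] F) (d r : ℝ) (h : F → ℝ) :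
    ∫ z in sphere (0 : F) r, h z ∂(μH[d]) = ∫ z in sphere (0 : E) r, h (L z) ∂(μH[d]) := by
  have := (L.toIsometryEquiv.measurePreserving_hausdorffMeasure d).setIntegral_preimage_emb
    L.toHomeomorph.measurableEmbedding h (sphere 0 r)
  rw [← this]
  congr 2
  ext z
  simp

/-- The 2D filtered backprojection inversion formula of Finch–Haltmeier–Rakesh
(filtration form): for `f` smooth supported in the open disk `B` of radius `R` and
`g(z,t)` its integrals over circles of radius `t` centered at `z ∈ S = ∂B`,
`f(y) = (1/(4π²R)) ∫_S ∫_0^{2R} ∂/∂t ( t ∂/∂t (g(z,t)/t) ) log|t² - ‖y-z‖²| dt dl(z)`. -/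
theorem finch_inversion_formula_2d_filtration_form
    (R : ℝ) (hR : 0 < R)
    (f : EuclideanSpace ℝ (Fin 2) → ℝ)
    (hf_smooth : ContDiff ℝ (⊤ : ℕ∞) f)
    (hf_supp : tsupport f ⊆ ball (0 : EuclideanSpace ℝ (Fin 2)) R)
    (g : EuclideanSpace ℝ (Fin 2) → ℝ → ℝ)
    (hg : ∀ z t, g z t =
      t * ∫ s in sphere (0 : EuclideanSpace ℝ (Fin 2)) 1, f (z + t • s) ∂(μH[1])) :
    ∀ y ∈ ball (0 : EuclideanSpace ℝ (Fin 2)) R,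
      f y = (1 / (4 * π ^ 2 * R)) *
        ∫ z in sphere (0 : EuclideanSpace ℝ (Fin 2)) R,
          (∫ t in (0 : ℝ)..(2 * R),
            deriv (fun u => u * deriv (fun w => g z w / w) u) t *
              Real.log |t ^ 2 - ‖y - z‖ ^ 2|) ∂(μH[1]) := by
  intro y hy
  let L : ℂ ≃ₗᵢ[ℝ] EuclideanSpace ℝ (Fin 2) := Complex.orthonormalBasisOneI.repr
  obtain ⟨y, rfl⟩ := L.surjective y
  set k : ℂ → ℝ := f ∘ L with hk
  have hkd : ContDiff ℝ 2 k :=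
    (contDiff_infty.1 hf_smooth 2).comp L.toContinuousLinearEquiv.contDiff
  have hks : tsupport k ⊆ ball 0 R := by
    intro x hx
    have hx' : x ∈ L.toHomeomorph ⁻¹' tsupport f :=
      tsupport_comp_eq_preimage f L.toHomeomorph ▸ hx
    simpa using hf_supp hx'
  have hgk : ∀ z t, g (L z) t = t * ∫ θ in 0..(2 * π), k (circleMap z t θ) := by
    intro z t
    rw [hg, L.setIntegral_sphere_hausdorffMeasure, setIntegral_sphere_hausdorffMeasure one_pos,
      one_mul]
    simp only [hk, Function.comp_apply, ← map_smul, ← map_add]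
    simp [circleMap]
  have hderiv : ∀ z t, 0 < t → deriv (fun u => u * deriv (fun w => g (L z) w / w) u) t =
      t * ∫ θ in 0..(2 * π), Laplacian.laplacian k (circleMap z t θ) := by
    intro z t ht
    rw [← (hkd.hasDerivAt_mul_deriv_integral_circleMap z ht.ne').deriv]
    refine Filter.EventuallyEq.deriv_eq ?_
    filter_upwards [Ioi_mem_nhds ht] with u hu
    congr 1
    refine Filter.EventuallyEq.deriv_eq ?_
    filter_upwards [Ioi_mem_nhds hu.out] with w hw
    rw [hgk, mul_div_cancel_left₀ _ hw.out.ne']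
  have key := hkd.eq_integral_circleMap_log hR hks (y := y)
    (by simpa using (mem_ball_zero_iff.1 hy).le)
  rw [L.setIntegral_sphere_hausdorffMeasure, setIntegral_sphere_hausdorffMeasure hR]
  have hinner : ∀ θ, (∫ t in (0 : ℝ)..(2 * R),
      deriv (fun u => u * deriv (fun w => g (L (circleMap 0 R θ)) w / w) u) t *
        Real.log |t ^ 2 - ‖L y - L (circleMap 0 R θ)‖ ^ 2|) = ∫ t in (0 : ℝ)..(2 * R),
      (t * ∫ φ in 0..(2 * π), Laplacian.laplacian k (circleMap (circleMap 0 R θ) t φ)) *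
        Real.log |t ^ 2 - ‖y - circleMap 0 R θ‖ ^ 2| := by
    intro θ
    rw [← map_sub, L.norm_map, intervalIntegral.integral_of_le (by positivity),
      intervalIntegral.integral_of_le (by positivity)]
    refine setIntegral_congr_fun measurableSet_Ioc fun t ht => ?_
    simp only [hderiv _ t ht.1]
  simp only [hinner, ← key]
  rw [show f (L y) = k y from rfl]
  field_simp
end

section
/- Let R > 0, let B ⊂ ℝ² be the open disk of radius R centered at the origin and S = {z ∈ ℝ² : ‖z‖ = R} its boundary circle. Let f : ℝ² → ℝ be smooth with support contained in B. For z ∈ S and t > 0, let g(z, t) = t ∫_{S¹} f(z + t s) dσ(s). Then for every y ∈ B, f(y) = (1/(4π² R)) Δ_y ∫_S ∫_0^{2R} g(z, t) log| t² − ‖y − z‖² | dt dl(z), where Δ_y is the Laplacian in the variable y applied to the function of y defined by the double integral, and dl is the arclength measure on S. -/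
open MeasureTheory Metric Real

/-- The Euclidean Laplacian: sum of second derivatives along the standard
orthonormal basis directions. -/
noncomputable def euclideanLaplacian {n : ℕ} (f : EuclideanSpace ℝ (Fin n) → ℝ)
    (x : EuclideanSpace ℝ (Fin n)) : ℝ :=
  ∑ i : Fin n, deriv (deriv (fun t : ℝ => f (x + t • EuclideanSpace.single i 1))) 0

theorem injOn_circleMap_Ioc_s9 {r : ℝ} (hr : r ≠ 0) (a : ℝ) :
    Set.InjOn (circleMap 0 r) (Set.Ioc a (a + 2 * π)) := by
  intro x hx y hy h
  exact eq_of_circleMap_eq hr (by rw [abs_lt]; constructor <;> linarith [hx.1, hx.2, hy.1, hy.2]) h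

theorem circleMap_image_Ioc {r : ℝ} (hr : 0 < r) (a : ℝ) :
    circleMap 0 r '' Set.Ioc a (a + 2 * π) = sphere 0 r := by
  rw [(periodic_circleMap 0 r).image_Ioc two_pi_pos, range_circleMap, abs_of_pos hr]

theorem ofReal_sin_le_hausdorffMeasure_arc (r b : ℝ) {h : ℝ} (h0 : 0 ≤ h) :
    ENNReal.ofReal (r * sin h) ≤ μH[1] (circleMap 0 r '' Set.Ioc b (b + h)) := by
  set p : ℂ → ℝ := fun z => (z * Complex.exp (-(b * Complex.I))).im with hp
  have hlip : LipschitzWith 1 p := by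
    refine LipschitzWith.of_dist_le_mul fun x y => ?_
    rw [Real.dist_eq, hp, ← Complex.sub_im, ← sub_mul, NNReal.coe_one, one_mul, dist_eq_norm]
    refine (Complex.abs_im_le_norm _).trans ?_
    rw [norm_mul, ← neg_mul, ← Complex.ofReal_neg, Complex.norm_exp_ofReal_mul_I, mul_one]
  have hpc (t : ℝ) : p (circleMap 0 r t) = r * sin (t - b) := by
    simp only [hp, circleMap_zero, mul_assoc, ← Complex.exp_add]
    rw [← sub_eq_add_neg, ← sub_mul, ← Complex.ofReal_sub, Complex.im_ofReal_mul,
      Complex.exp_ofReal_mul_I_im]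
  calc ENNReal.ofReal (r * sin h) = volume (Set.Ioc (r * sin (b - b)) (r * sin (b + h - b))) := by
        simp
    _ ≤ volume ((fun t => r * sin (t - b)) '' Set.Ioc b (b + h)) :=
        measure_mono (intermediate_value_Ioc (f := fun t => r * sin (t - b)) (by linarith)
          (by fun_prop))
    _ = μH[1] (p '' (circleMap 0 r '' Set.Ioc b (b + h))) := by
        rw [Set.image_image, hausdorffMeasure_real]; simp_rw [hpc]
    _ ≤ μH[1] (circleMap 0 r '' Set.Ioc b (b + h)) := by
        simpa using hlip.hausdorffMeasure_image_le zero_le_one (circleMap 0 r '' Set.Ioc b (b + h))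

theorem ofReal_nat_mul_sin_le_hausdorffMeasure_arc {r : ℝ} (hr : 0 < r) (a : ℝ) {h : ℝ}
    (h0 : 0 ≤ h) (hsin : 0 ≤ sin h) (n : ℕ) (hn : n * h ≤ 2 * π) :
    ENNReal.ofReal (n * (r * sin h)) ≤ μH[1] (circleMap 0 r '' Set.Ioc a (a + n * h)) := by
  induction n with
  | zero => simp
  | succ n ih =>
    push_cast at hn ⊢
    have hnh : 0 ≤ n * h := by positivity
    have hinj := injOn_circleMap_Ioc_s9 hr.ne' a
    have hsplit : Set.Ioc a (a + (n + 1) * h)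
        = Set.Ioc a (a + n * h) ∪ Set.Ioc (a + n * h) (a + n * h + h) := by
      rw [Set.Ioc_union_Ioc_eq_Ioc (by linarith) (by linarith)]; ring_nf
    have hs1 : Set.Ioc a (a + n * h) ⊆ Set.Ioc a (a + 2 * π) :=
      Set.Ioc_subset_Ioc_right (by linarith)
    have hs2 : Set.Ioc (a + n * h) (a + n * h + h) ⊆ Set.Ioc a (a + 2 * π) :=
      Set.Ioc_subset_Ioc (by linarith) (by linarith)
    rw [hsplit, Set.image_union, measure_union, add_mul, one_mul,
      ENNReal.ofReal_add (by positivity) (by positivity)]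
    · exact add_le_add (ih (by linarith)) (ofReal_sin_le_hausdorffMeasure_arc r _ h0)
    · rw [Set.disjoint_iff_inter_eq_empty, ← hinj.image_inter hs1 hs2,
        (Set.Ioc_disjoint_Ioc_of_le le_rfl).inter_eq, Set.image_empty]
    · exact measurableSet_Ioc.image_of_continuousOn_injOn (continuous_circleMap 0 r).continuousOn
        (hinj.mono hs2)

theorem ofReal_le_hausdorffMeasure_circle {r : ℝ} (hr : 0 < r) :
    ENNReal.ofReal (r * (2 * π)) ≤ μH[1] (sphere (0 : ℂ) r) := by
  have hlim : Filter.Tendsto (fun n : ℕ => ENNReal.ofReal (r * (2 * π) * sinc (2 * π / n)))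
      Filter.atTop (nhds (ENNReal.ofReal (r * (2 * π) * sinc 0))) :=
    ENNReal.tendsto_ofReal (((continuous_sinc.tendsto 0).comp
      (tendsto_const_div_atTop_nhds_zero_nat _)).const_mul _)
  rw [sinc_zero, mul_one] at hlim
  refine le_of_tendsto hlim ?_
  filter_upwards [Filter.eventually_ge_atTop 2] with n hn
  have hn' : (2 : ℝ) ≤ n := by exact_mod_cast hn
  have hn0 : (0 : ℝ) < n := by linarith
  have hle : n * (2 * π / n) ≤ 2 * π := by field_simp; rfl
  have h0 : 0 < 2 * π / n := by positivity
  have hsin : 0 ≤ sin (2 * π / n) := sin_nonneg_of_nonneg_of_le_pi h0.le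
    (by rw [div_le_iff₀ hn0]; nlinarith [pi_pos])
  refine le_trans (le_of_eq ?_) ((ofReal_nat_mul_sin_le_hausdorffMeasure_arc hr 0 h0.le hsin n
    hle).trans (measure_mono ?_))
  · rw [sinc_of_ne_zero h0.ne']; congr 1; field_simp
  · rw [← circleMap_image_Ioc hr 0]
    exact Set.image_mono (Set.Ioc_subset_Ioc_right (by linarith))

theorem hausdorffMeasure_restrict_circle {r : ℝ} (hr : 0 < r) (a : ℝ) :
    (μH[1]).restrict (sphere (0 : ℂ) r) =
      ENNReal.ofReal r • (volume.restrict (Set.Ioc a (a + 2 * π))).map (circleMap 0 r) := by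
  have hmeas : Measurable (circleMap 0 r) := (continuous_circleMap 0 r).measurable
  set ν := ENNReal.ofReal r • (volume.restrict (Set.Ioc a (a + 2 * π))).map (circleMap 0 r) with hν
  have hνs {s : Set ℂ} (hs : MeasurableSet s) :
      ν s = ENNReal.ofReal r * volume (circleMap 0 r ⁻¹' s ∩ Set.Ioc a (a + 2 * π)) := by
    rw [hν, Measure.smul_apply, Measure.map_apply hmeas hs, Measure.restrict_apply (hmeas hs),
      smul_eq_mul]
  have hle : (μH[1]).restrict (sphere (0 : ℂ) r) ≤ ν := by
    refine Measure.le_iff.2 fun s hs => ?_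
    rw [Measure.restrict_apply hs, hνs hs, ← circleMap_image_Ioc hr a,
      ← Set.image_preimage_inter]
    have := (lipschitzWith_circleMap 0 r).hausdorffMeasure_image_le zero_le_one
      (circleMap 0 r ⁻¹' s ∩ Set.Ioc a (a + 2 * π))
    rw [hausdorffMeasure_real, ENNReal.rpow_one] at this
    convert this using 2
    rw [ENNReal.ofReal, Real.nnabs_of_nonneg hr.le]
  have huniv : ν Set.univ = ENNReal.ofReal (r * (2 * π)) := by
    rw [hνs MeasurableSet.univ, ENNReal.ofReal_mul hr.le]; simp
  have hfin : IsFiniteMeasure ν := ⟨by rw [huniv]; exact ENNReal.ofReal_lt_top⟩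
  have : IsFiniteMeasure ((μH[1]).restrict (sphere (0 : ℂ) r)) := isFiniteMeasure_of_le ν hle
  refine Measure.eq_of_le_of_measure_univ_eq hle (le_antisymm (hle _) ?_)
  rw [huniv, Measure.restrict_apply_univ]
  exact ofReal_le_hausdorffMeasure_circle hr

theorem setIntegral_hausdorffMeasure_circle {r : ℝ} (hr : 0 < r) (a : ℝ) {h : ℂ → ℝ}
    (hh : StronglyMeasurable h) :
    ∫ z in sphere (0 : ℂ) r, h z ∂μH[1]
      = r * ∫ θ in Set.Ioc a (a + 2 * π), h (circleMap 0 r θ) := by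
  rw [hausdorffMeasure_restrict_circle hr a, integral_smul_measure,
    integral_map (continuous_circleMap 0 r).aemeasurable hh.aestronglyMeasurable,
    ENNReal.toReal_ofReal hr.le, smul_eq_mul]

theorem exists_factorization_norm_sq_sub_norm_sq {R : ℝ} (hR : 0 < R) {x w : ℂ}
    (hx : ‖x‖ < R) (hw : ‖w‖ < R) (hxw : x ≠ w) :
    ∃ z₁ ∈ sphere (0 : ℂ) R, ∃ z₂ ∈ sphere (0 : ℂ) R, ∀ z ∈ sphere (0 : ℂ) R,
      R * |‖x - z‖ ^ 2 - ‖w - z‖ ^ 2| = ‖x - w‖ * ‖z - z₁‖ * ‖z - z₂‖ := by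
  have hd0 : x - w ≠ 0 := sub_ne_zero.2 hxw
  obtain ⟨d, hd⟩ : ∃ d, d = x - w := ⟨_, rfl⟩
  rw [← hd] at hd0
  have hdn : 0 < ‖d‖ := norm_pos_iff.2 hd0
  have hcd : starRingEnd ℂ d ≠ 0 := by simpa using hd0
  obtain ⟨c, hc⟩ : ∃ c, c = ‖x‖ ^ 2 - ‖w‖ ^ 2 := ⟨_, rfl⟩
  have hcle : c ^ 2 ≤ 4 * R ^ 2 * ‖d‖ ^ 2 := by
    have h1 : |‖x‖ - ‖w‖| ≤ ‖d‖ := hd ▸ abs_norm_sub_norm_le x w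
    have h2 : |c| ≤ 2 * R * ‖d‖ := by
      rw [hc, sq_sub_sq, abs_mul, abs_of_nonneg (by positivity : 0 ≤ ‖x‖ + ‖w‖)]
      gcongr
      linarith
    calc c ^ 2 = |c| ^ 2 := (sq_abs c).symm
      _ ≤ (2 * R * ‖d‖) ^ 2 := by gcongr
      _ = _ := by ring
  obtain ⟨D, hD⟩ : ∃ D : ℝ, c ^ 2 + D ^ 2 = 4 * R ^ 2 * ‖d‖ ^ 2 :=
    ⟨√(4 * R ^ 2 * ‖d‖ ^ 2 - c ^ 2), by rw [sq_sqrt (by linarith)]; ring⟩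
  have hroot (s : ℝ) (hs : c ^ 2 + s ^ 2 = 4 * R ^ 2 * ‖d‖ ^ 2) :
      ((c : ℂ) + s * Complex.I) / (2 * starRingEnd ℂ d) ∈ sphere (0 : ℂ) R := by
    rw [mem_sphere_zero_iff_norm, norm_div, norm_mul, RCLike.norm_conj, Complex.norm_add_mul_I, hs,
      show 4 * R ^ 2 * ‖d‖ ^ 2 = (2 * R * ‖d‖) ^ 2 by ring, sqrt_sq (by positivity)]
    simp only [Complex.norm_ofNat]
    field_simp
  refine ⟨_, hroot D hD, _, hroot (-D) (by rw [neg_sq, hD]), fun z hz => ?_⟩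
  have hzn : ‖z‖ = R := by simpa using hz
  have hzz : z * starRingEnd ℂ z = (R : ℂ) ^ 2 := by rw [Complex.mul_conj', hzn]
  have hDC : (c : ℂ) ^ 2 + (D : ℂ) ^ 2 = 4 * R ^ 2 * (d * starRingEnd ℂ d) := by
    rw [Complex.mul_conj']; exact_mod_cast hD
  have hcC : (c : ℂ) = x * starRingEnd ℂ x - w * starRingEnd ℂ w := by
    rw [Complex.mul_conj', Complex.mul_conj']; exact_mod_cast hc
  have key : -z * ((‖x - z‖ ^ 2 - ‖w - z‖ ^ 2 : ℝ) : ℂ) =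
      starRingEnd ℂ d * (z - ((c : ℂ) + D * Complex.I) / (2 * starRingEnd ℂ d)) *
        (z - ((c : ℂ) + (-D : ℝ) * Complex.I) / (2 * starRingEnd ℂ d)) := by
    have e1 : starRingEnd ℂ d * (z - ((c : ℂ) + D * Complex.I) / (2 * starRingEnd ℂ d)) *
        (z - ((c : ℂ) + (-D : ℝ) * Complex.I) / (2 * starRingEnd ℂ d)) =
        starRingEnd ℂ d * z ^ 2 - c * z + (c ^ 2 + D ^ 2) / (4 * starRingEnd ℂ d) := by
      push_cast
      field_simp
      linear_combination (-4 * (D : ℂ) ^ 2) * Complex.I_sq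
    rw [e1, hDC, Complex.ofReal_sub, Complex.ofReal_pow, Complex.ofReal_pow, ← Complex.mul_conj',
      ← Complex.mul_conj', hcC]
    have e2 : 4 * (R : ℂ) ^ 2 * (d * starRingEnd ℂ d) / (4 * starRingEnd ℂ d) = R ^ 2 * d := by
      field_simp
    rw [e2, ← hzz, hd]
    simp only [map_sub]
    ring
  have := congrArg norm key
  rwa [norm_mul, norm_mul, norm_mul, norm_neg, hzn, RCLike.norm_conj, Complex.norm_real,
    Real.norm_eq_abs, congrArg norm hd] at this

theorem circleAverage_log_norm_sq_sub_norm_sq {R : ℝ} (hR : 0 < R) {x w : ℂ}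
    (hx : ‖x‖ < R) (hw : ‖w‖ < R) (hxw : x ≠ w) :
    CircleIntegrable (fun z => log |‖x - z‖ ^ 2 - ‖w - z‖ ^ 2|) 0 R ∧
    circleAverage (fun z => log |‖x - z‖ ^ 2 - ‖w - z‖ ^ 2|) 0 R = log (R * ‖x - w‖) := by
  obtain ⟨z₁, h₁, z₂, h₂, hfac⟩ := exists_factorization_norm_sq_sub_norm_sq hR hx hw hxw
  have hd : 0 < ‖x - w‖ := norm_pos_iff.2 (sub_ne_zero.2 hxw)
  have hae : (fun z => log (‖x - w‖ / R) + (log ‖z - z₁‖ + log ‖z - z₂‖))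
      =ᶠ[Filter.codiscreteWithin (sphere 0 |R|)] fun z => log |‖x - z‖ ^ 2 - ‖w - z‖ ^ 2| := by
    filter_upwards [compl_finite_mem_codiscreteWithin (t := ({z₁, z₂} : Set ℂ))
      (s := sphere (0 : ℂ) |R|) (Set.toFinite _), Filter.self_mem_codiscreteWithin (sphere (0 : ℂ) |R|)] with z hz hzs
    rw [abs_of_pos hR] at hzs
    simp only [Set.mem_compl_iff, Set.mem_insert_iff, Set.mem_singleton_iff, not_or] at hz
    have e : |‖x - z‖ ^ 2 - ‖w - z‖ ^ 2| = ‖x - w‖ / R * (‖z - z₁‖ * ‖z - z₂‖) := by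
      have := hfac z hzs
      field_simp
      linarith
    have n1 : ‖z - z₁‖ ≠ 0 := norm_ne_zero_iff.2 (sub_ne_zero.2 hz.1)
    have n2 : ‖z - z₂‖ ≠ 0 := norm_ne_zero_iff.2 (sub_ne_zero.2 hz.2)
    rw [e, log_mul (by positivity) (mul_ne_zero n1 n2), log_mul n1 n2]
  have i1 := circleIntegrable_log_norm_sub_const (a := z₁) (c := 0) R
  have i2 := circleIntegrable_log_norm_sub_const (a := z₂) (c := 0) R
  have i0 := circleIntegrable_const (log (‖x - w‖ / R)) 0 R
  have i12 : CircleIntegrable (fun z => log ‖z - z₁‖ + log ‖z - z₂‖) 0 R := i1.add i2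
  refine ⟨(i0.add i12).congr_codiscreteWithin hae, ?_⟩
  rw [← circleAverage_congr_codiscreteWithin hae hR.ne', circleAverage_fun_add i0 i12,
    circleAverage_fun_add i1 i2, circleAverage_const,
    circleAverage_log_norm_sub_const_of_mem_closedBall (by
      rw [abs_of_pos hR]; exact sphere_subset_closedBall h₁),
    circleAverage_log_norm_sub_const_of_mem_closedBall (by
      rw [abs_of_pos hR]; exact sphere_subset_closedBall h₂),
    log_div hd.ne' hR.ne', log_mul hR.ne' hd.ne']
  ring

theorem integral_log_norm_sq_sub_norm_sq {R : ℝ} (hR : 0 < R) {x w : ℂ}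
    (hx : ‖x‖ < R) (hw : ‖w‖ < R) (hxw : x ≠ w) :
    IntegrableOn (fun θ => log |‖x - circleMap 0 R θ‖ ^ 2 - ‖w - circleMap 0 R θ‖ ^ 2|)
      (Set.Ioc 0 (2 * π)) ∧
    ∫ θ in Set.Ioc 0 (2 * π), log |‖x - circleMap 0 R θ‖ ^ 2 - ‖w - circleMap 0 R θ‖ ^ 2| =
      2 * π * log (R * ‖x - w‖) := by
  obtain ⟨hi, ha⟩ := circleAverage_log_norm_sq_sub_norm_sq hR hx hw hxw
  rw [CircleIntegrable, intervalIntegrable_iff_integrableOn_Ioc_of_le two_pi_pos.le] at hi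
  refine ⟨hi, ?_⟩
  rw [circleAverage_def, intervalIntegral.integral_of_le two_pi_pos.le, smul_eq_mul] at ha
  rw [← ha]
  field_simp

theorem locallyIntegrable_log_norm : LocallyIntegrable (fun x : ℂ => log ‖x‖) := by
  refine locallyIntegrable_iff.2 fun K hK => ?_
  obtain ⟨M, hM⟩ := hK.isBounded.subset_ball 0
  refine IntegrableOn.mono_set ?_ hM
  rw [integrableOn_fun_norm_addHaar volume (f := log), Complex.finrank_real_complex]
  refine (Continuous.integrableOn_Icc (a := 0) (b := M) ?_).mono_set Set.Ioo_subset_Icc_self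
  simpa using continuous_mul_log

theorem integrable_mul_log_norm {u : ℂ → ℝ} (hu : Continuous u) (hc : HasCompactSupport u) :
    Integrable fun x => log ‖x‖ * u x :=
  (locallyIntegrable_log_norm.integrable_smul_left_of_hasCompactSupport hu hc).congr
    (.of_forall fun x => by simp [mul_comm])

theorem integrable_mul_log_norm_sub {u : ℂ → ℝ} (hu : Continuous u) (hc : HasCompactSupport u)
    (w : ℂ) : Integrable fun x => u x * log ‖x - w‖ := by
  have := (integrable_mul_log_norm (u := fun x => u (x + w)) (by fun_prop)
    (hc.comp_homeomorph (Homeomorph.addRight w))).comp_sub_right w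
  simpa [mul_comm] using this

theorem hasDerivAt_integral_log_norm_mul {u : ℂ → ℝ} (hu : ContDiff ℝ 1 u)
    (hc : HasCompactSupport u) (w v : ℂ) (t : ℝ) :
    HasDerivAt (fun s : ℝ => ∫ x, log ‖x‖ * u (w + s • v - x))
      (∫ x, log ‖x‖ * fderiv ℝ u (w + t • v - x) v) t := by
  have h1 := hc.hasFDerivAt_convolution_right (ContinuousLinearMap.mul ℝ ℝ)
    locallyIntegrable_log_norm hu (w + t • v)
  have h2 : HasDerivAt (fun s : ℝ => w + s • v) v t := by
    simpa using ((hasDerivAt_id t).smul_const v).const_add w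
  have h3 := h1.comp_hasDerivAt t h2
  rw [convolution_precompR_apply _ locallyIntegrable_log_norm (hc.fderiv (𝕜 := ℝ))
    (hu.continuous_fderiv one_ne_zero)] at h3
  exact h3

theorem deriv_deriv_integral_log_norm_mul {u : ℂ → ℝ} (hu : ContDiff ℝ 2 u)
    (hc : HasCompactSupport u) (w v : ℂ) :
    deriv (deriv fun s : ℝ => ∫ x, log ‖x‖ * u (w + s • v - x)) 0 =
      ∫ x, log ‖x‖ * fderiv ℝ (fun y => fderiv ℝ u y v) (w - x) v := by
  have e : (deriv fun s : ℝ => ∫ x, log ‖x‖ * u (w + s • v - x)) =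
      fun s : ℝ => ∫ x, log ‖x‖ * fderiv ℝ u (w + s • v - x) v :=
    funext fun s => (hasDerivAt_integral_log_norm_mul (hu.of_le one_le_two) hc w v s).deriv
  have hu' : ContDiff ℝ 1 fun y => fderiv ℝ u y v :=
    (hu.fderiv_right (m := 1) (by norm_num)).clm_apply contDiff_const
  rw [e, (hasDerivAt_integral_log_norm_mul hu' (hc.fderiv_apply (𝕜 := ℝ) v) w v 0).deriv]
  simp

theorem hasFDerivAt_log_norm_sq_add {ε : ℝ} (hε : 0 < ε) (x : ℂ) :
    HasFDerivAt (fun y : ℂ => log (‖y‖ ^ 2 + ε) / 2) ((‖x‖ ^ 2 + ε)⁻¹ • innerSL ℝ x) x := by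
  have h := ((((hasStrictFDerivAt_norm_sq x).hasFDerivAt).add_const ε).log
    (by positivity)).mul_const (2⁻¹ : ℝ)
  refine (h.congr_fderiv ?_).congr_of_eventuallyEq (.of_forall fun y => by simp [div_eq_mul_inv])
  ext v
  simp
  ring

theorem contDiff_log_norm_sq_add {ε : ℝ} (hε : 0 < ε) :
    ContDiff ℝ 1 fun y : ℂ => log (‖y‖ ^ 2 + ε) / 2 :=
  (((contDiff_norm_sq ℝ).add contDiff_const).log fun x => by positivity).div_const _

theorem integral_log_norm_sq_add_mul_fderiv {u : ℂ → ℝ} (hu : ContDiff ℝ 1 u)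
    (hc : HasCompactSupport u) {ε : ℝ} (hε : 0 < ε) (v : ℂ) :
    ∫ x, log (‖x‖ ^ 2 + ε) / 2 * fderiv ℝ u x v =
      -∫ x, (‖x‖ ^ 2 + ε)⁻¹ * (inner ℝ x v * u x) := by
  have hℓ := contDiff_log_norm_sq_add hε
  have hf (x : ℂ) : fderiv ℝ (fun y : ℂ => log (‖y‖ ^ 2 + ε) / 2) x v =
      (‖x‖ ^ 2 + ε)⁻¹ * inner ℝ x v := by
    rw [(hasFDerivAt_log_norm_sq_add hε x).fderiv]; simp
  have hcont : Continuous fun x : ℂ => fderiv ℝ (fun y : ℂ => log (‖y‖ ^ 2 + ε) / 2) x v :=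
    (hℓ.continuous_fderiv one_ne_zero).clm_apply continuous_const
  have hcu : Continuous fun x : ℂ => fderiv ℝ u x v :=
    (hu.continuous_fderiv one_ne_zero).clm_apply continuous_const
  rw [integral_mul_fderiv_eq_neg_fderiv_mul_of_integrable]
  · simp_rw [hf, mul_assoc]
  · exact (hcont.mul hu.continuous).integrable_of_hasCompactSupport hc.mul_left
  · exact (hℓ.continuous.mul hcu).integrable_of_hasCompactSupport
      (hc.fderiv_apply (𝕜 := ℝ) v).mul_left
  · exact (hℓ.continuous.mul hu.continuous).integrable_of_hasCompactSupport hc.mul_left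
  · exact fun x _ => hℓ.differentiable one_ne_zero x
  · exact fun x _ => hu.differentiable one_ne_zero x

theorem tendsto_integral_log_norm_sq_add_mul {u : ℂ → ℝ} (hu : Continuous u)
    (hc : HasCompactSupport u) :
    Filter.Tendsto (fun n : ℕ => ∫ x, log (‖x‖ ^ 2 + 1 / ((n : ℝ) + 1)) / 2 * u x) Filter.atTop
      (nhds (∫ x, log ‖x‖ * u x)) := by
  obtain ⟨M, hM⟩ := hc.isBounded.subset_closedBall 0
  have hpos (n : ℕ) : 0 < 1 / ((n : ℝ) + 1) := Nat.one_div_pos_of_nat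
  refine tendsto_integral_of_dominated_convergence
    (fun x => |log ‖x‖ * u x| + log (M ^ 2 + 1) / 2 * |u x|) ?_ ?_ ?_ ?_
  · exact fun n =>
      ((contDiff_log_norm_sq_add (hpos n)).continuous.mul hu).aestronglyMeasurable
  · exact (integrable_mul_log_norm hu hc).abs.add
      ((hu.integrable_of_hasCompactSupport hc).abs.const_mul _)
  · intro n
    filter_upwards [Measure.ae_ne volume (0 : ℂ)] with x hx
    by_cases hxu : u x = 0
    · simp [hxu]
    have hxM : ‖x‖ ≤ M := by simpa using hM (subset_tsupport u hxu)
    have hxn : 0 < ‖x‖ := norm_pos_iff.2 hx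
    have h1 : log ‖x‖ ≤ log (‖x‖ ^ 2 + 1 / ((n : ℝ) + 1)) / 2 := by
      have := log_le_log (by positivity) (le_add_of_nonneg_right (a := ‖x‖ ^ 2) (hpos n).le)
      rw [log_pow] at this
      push_cast at this
      linarith
    have h2 : log (‖x‖ ^ 2 + 1 / ((n : ℝ) + 1)) ≤ log (M ^ 2 + 1) := by
      have : 1 / ((n : ℝ) + 1) ≤ 1 := by
        rw [div_le_one (by positivity)]; linarith [n.cast_nonneg (α := ℝ)]
      gcongr
    have h3 : 0 ≤ log (M ^ 2 + 1) := log_nonneg (by nlinarith)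
    rw [norm_mul, Real.norm_eq_abs, Real.norm_eq_abs, abs_mul, ← add_mul]
    gcongr
    rw [abs_le]
    constructor <;> linarith [neg_abs_le (log ‖x‖), abs_nonneg (log ‖x‖)]
  · filter_upwards [Measure.ae_ne volume (0 : ℂ)] with x hx
    have hxn : 0 < ‖x‖ := norm_pos_iff.2 hx
    have h := (tendsto_one_div_add_atTop_nhds_zero_nat (𝕜 := ℝ)).const_add (‖x‖ ^ 2)
    rw [add_zero] at h
    have := ((h.log (by positivity)).div_const 2).mul_const (u x)
    rw [log_pow] at this
    convert this using 3
    push_cast; ring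

theorem integral_radial_deriv {ψ : ℂ → ℝ} (hψ : ContDiff ℝ 1 ψ) (hc : HasCompactSupport ψ)
    {e : ℂ} (he : ‖e‖ = 1) : ∫ r in Set.Ioi (0 : ℝ), fderiv ℝ ψ (r • e) e = -ψ 0 := by
  have hcl : Topology.IsClosedEmbedding fun r : ℝ => r • e :=
    (Isometry.of_dist_eq fun a b => by
      rw [dist_eq_norm, ← sub_smul, norm_smul, he, mul_one, dist_eq_norm]).isClosedEmbedding
  have hd (r : ℝ) : HasDerivAt (fun r : ℝ => ψ (r • e)) (fderiv ℝ ψ (r • e) e) r := by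
    have h2 : HasDerivAt (fun s : ℝ => s • e) e r := by simpa using (hasDerivAt_id r).smul_const e
    exact (hψ.differentiable one_ne_zero _).hasFDerivAt.comp_hasDerivAt r h2
  have := HasCompactSupport.integral_Ioi_deriv_eq (f := fun r : ℝ => ψ (r • e))
    (hψ.comp (contDiff_id.smul contDiff_const)) (hc.comp_isClosedEmbedding hcl) 0
  rw [show deriv (fun r : ℝ => ψ (r • e)) = fun r => fderiv ℝ ψ (r • e) e from
    funext fun r => (hd r).deriv] at this
  simpa using this

theorem tendsto_integral_inv_norm_sq_add_mul_radial_fderiv {ψ : ℂ → ℝ} (hψ : ContDiff ℝ 1 ψ)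
    (hc : HasCompactSupport ψ) :
    Filter.Tendsto (fun n : ℕ => ∫ x, (‖x‖ ^ 2 + 1 / ((n : ℝ) + 1))⁻¹ * fderiv ℝ ψ x x)
      Filter.atTop (nhds (-(2 * π * ψ 0))) := by
  set e : ℝ → ℂ := fun θ => Real.cos θ + Real.sin θ * Complex.I with he
  have hec : Continuous e := by fun_prop
  have hen (θ : ℝ) : ‖e θ‖ = 1 := by
    simp only [he, Complex.norm_add_mul_I, cos_sq_add_sin_sq, sqrt_one]
  set G : ℝ × ℝ → ℝ := fun p => fderiv ℝ ψ (p.1 • e p.2) (e p.2) with hG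
  have hGc : Continuous G :=
    ((hψ.continuous_fderiv one_ne_zero).comp (by fun_prop)).clm_apply (by fun_prop)
  have htar : polarCoord.target = Set.Ioi (0 : ℝ) ×ˢ Set.Ioo (-π) π := rfl
  have hGi : IntegrableOn G polarCoord.target := by
    obtain ⟨N, hN⟩ := (hc.fderiv (𝕜 := ℝ)).isBounded.subset_closedBall 0
    have hK : IntegrableOn G (Set.Icc 0 N ×ˢ Set.Icc (-π) π) :=
      hGc.continuousOn.integrableOn_compact (isCompact_Icc.prod isCompact_Icc)
    refine hK.of_forall_sdiff_eq_zero polarCoord.open_target.measurableSet ?_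
    rintro p ⟨hp, hpn⟩
    rw [htar] at hp
    by_contra h0
    refine hpn ⟨⟨le_of_lt hp.1, ?_⟩, ⟨hp.2.1.le, hp.2.2.le⟩⟩
    have hne : fderiv ℝ ψ (p.1 • e p.2) ≠ 0 := fun h => h0 (by
      rw [hG]; dsimp only; rw [h]; rfl)
    have := hN (subset_tsupport _ hne)
    rw [mem_closedBall_zero_iff, norm_smul, hen, mul_one, Real.norm_of_nonneg (le_of_lt hp.1)]
      at this
    exact this
  have hlim : ∫ p in polarCoord.target, G p = -(2 * π * ψ 0) := by
    rw [htar, Measure.volume_eq_prod, ← Measure.prod_restrict, integral_prod_symm]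
    · simp_rw [hG, integral_radial_deriv hψ hc (hen _)]
      rw [setIntegral_const, Real.volume_real_Ioo_of_le (by linarith [pi_pos]), smul_eq_mul]
      ring
    · rw [Measure.prod_restrict, ← Measure.volume_eq_prod, ← htar]
      exact hGi
  have hpolar (n : ℕ) : ∫ x, (‖x‖ ^ 2 + 1 / ((n : ℝ) + 1))⁻¹ * fderiv ℝ ψ x x =
      ∫ p in polarCoord.target, p.1 ^ 2 / (p.1 ^ 2 + 1 / ((n : ℝ) + 1)) * G p := by
    rw [← Complex.integral_comp_polarCoord_symm]
    refine integral_congr_ae (.of_forall fun p => ?_)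
    have hs : Complex.polarCoord.symm p = p.1 • e p.2 := by
      rw [Complex.polarCoord_symm_apply, Complex.real_smul]
    simp only [hs, norm_smul, hen, mul_one, Real.norm_eq_abs, sq_abs, map_smul, smul_eq_mul, hG]
    ring
  simp_rw [hpolar]
  rw [← hlim]
  refine tendsto_integral_of_dominated_convergence (fun p => |G p|) ?_ hGi.abs ?_ ?_
  · intro n
    refine (Continuous.mul (Continuous.div (by fun_prop) (by fun_prop) fun p => ?_)
      hGc).aestronglyMeasurable
    positivity
  · refine fun n => .of_forall fun p => ?_
    have : 0 < 1 / ((n : ℝ) + 1) := Nat.one_div_pos_of_nat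
    rw [norm_mul, Real.norm_of_nonneg (by positivity), Real.norm_eq_abs]
    refine mul_le_of_le_one_left (abs_nonneg _) ?_
    rw [div_le_one (by positivity)]
    linarith
  · filter_upwards [ae_restrict_mem polarCoord.open_target.measurableSet] with p hp
    rw [htar] at hp
    have hp0 : p.1 ^ 2 ≠ 0 := pow_ne_zero 2 (ne_of_gt hp.1)
    have h := (tendsto_one_div_add_atTop_nhds_zero_nat (𝕜 := ℝ)).const_add (p.1 ^ 2)
    rw [add_zero] at h
    have := ((tendsto_const_nhds (x := p.1 ^ 2)).div h hp0).mul_const (G p)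
    rwa [div_self hp0, one_mul] at this

theorem integral_log_norm_mul_laplacian {ψ : ℂ → ℝ} (hψ : ContDiff ℝ 2 ψ)
    (hc : HasCompactSupport ψ) :
    (∫ x, log ‖x‖ * fderiv ℝ (fun y => fderiv ℝ ψ y 1) x 1) +
      ∫ x, log ‖x‖ * fderiv ℝ (fun y => fderiv ℝ ψ y Complex.I) x Complex.I = 2 * π * ψ 0 := by
  have hD (v : ℂ) : ContDiff ℝ 1 fun y => fderiv ℝ ψ y v :=
    (hψ.fderiv_right (m := 1) (by norm_num)).clm_apply contDiff_const
  have hDc (v : ℂ) : HasCompactSupport fun y => fderiv ℝ ψ y v := hc.fderiv_apply (𝕜 := ℝ) v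
  have hlim (v : ℂ) := tendsto_integral_log_norm_sq_add_mul
    (((hD v).continuous_fderiv one_ne_zero).clm_apply (continuous_const (y := v)))
    ((hDc v).fderiv_apply (𝕜 := ℝ) v)
  refine tendsto_nhds_unique ((hlim 1).add (hlim Complex.I)) ?_
  have h := (tendsto_integral_inv_norm_sq_add_mul_radial_fderiv (hψ.of_le one_le_two) hc).neg
  rw [neg_neg] at h
  refine h.congr fun n => ?_
  have hpos : 0 < 1 / ((n : ℝ) + 1) := Nat.one_div_pos_of_nat
  have hint (v : ℂ) : Integrable fun x : ℂ =>
      (‖x‖ ^ 2 + 1 / ((n : ℝ) + 1))⁻¹ * (inner ℝ x v * fderiv ℝ ψ x v) :=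
    ((Continuous.inv₀ (by fun_prop) fun x => by positivity).mul
      ((continuous_id.inner continuous_const).mul (hD v).continuous)).integrable_of_hasCompactSupport
      (hDc v).mul_left.mul_left
  rw [integral_log_norm_sq_add_mul_fderiv (hD 1) (hDc 1) hpos,
    integral_log_norm_sq_add_mul_fderiv (hD Complex.I) (hDc Complex.I) hpos, ← neg_add,
    ← integral_add (hint 1) (hint Complex.I)]
  congr 2
  funext x
  rw [← mul_add]
  congr 1
  have hx : x = x.re • (1 : ℂ) + x.im • Complex.I := by simp [Complex.re_add_im]
  conv_lhs => rw [hx, map_add, map_smul, map_smul, ← hx]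
  simp [Complex.inner]

theorem laplacian_log_potential {φ : ℂ → ℝ} (hφ : ContDiff ℝ 2 φ) (hc : HasCompactSupport φ)
    (w : ℂ) :
    deriv (deriv fun t : ℝ => ∫ x, φ x * log ‖x - (w + t • (1 : ℂ))‖) 0 +
      deriv (deriv fun t : ℝ => ∫ x, φ x * log ‖x - (w + t • Complex.I)‖) 0 = 2 * π * φ w := by
  have h (v : ℂ) : (fun t : ℝ => ∫ x, φ x * log ‖x - (w + t • v)‖) =
      fun t : ℝ => ∫ x, log ‖x‖ * φ (w + t • v - x) := by
    funext t
    rw [← integral_sub_left_eq_self _ volume (w + t • v)]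
    congr 1
    funext x
    rw [sub_sub_cancel_left, norm_neg, mul_comm]
  have hs (v : ℂ) : ∫ x, log ‖x‖ * fderiv ℝ (fun y => fderiv ℝ φ y v) (w - x) v =
      ∫ x, log ‖x‖ * fderiv ℝ (fun y => fderiv ℝ (fun z => φ (w + z)) y v) x v := by
    rw [← integral_neg_eq_self]
    simp_rw [fderiv_comp_add_left, norm_neg, sub_neg_eq_add]
    simp_rw [fderiv_comp_add_left (f := fun y => fderiv ℝ φ y v)]
  rw [h, h, deriv_deriv_integral_log_norm_mul hφ hc, deriv_deriv_integral_log_norm_mul hφ hc,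
    hs, hs, integral_log_norm_mul_laplacian (ψ := fun z => φ (w + z)) (hφ.comp (by fun_prop))
    (hc.comp_homeomorph (Homeomorph.addLeft w)), add_zero]

theorem integrableOn_log_abs_sq_sub_sq (a b c : ℝ) :
    IntegrableOn (fun t : ℝ => log |t ^ 2 - a ^ 2|) (Set.Ioc b c) := by
  rcases le_total b c with h | h
  · have hm : MeromorphicOn (fun t : ℝ => t ^ 2 - a ^ 2) (Set.uIcc b c) := by
      intro t _
      fun_prop
    have h1 := (intervalIntegrable_iff_integrableOn_Ioc_of_le h).1 hm.intervalIntegrable_log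
    simpa only [Function.comp_def, log_abs] using h1
  · simp [Set.Ioc_eq_empty (not_lt.2 h)]

theorem integral_mul_log_norm_sq_sub_eq_integral_circle {R : ℝ} (hR : 0 < R) {φ : ℂ → ℝ}
    (hφ : Continuous φ) (hc : HasCompactSupport φ) (hs : tsupport φ ⊆ ball 0 R) {z : ℂ}
    (hz : ‖z‖ = R) (a : ℝ) :
    ∫ t in (0 : ℝ)..(2 * R),
      (t * ∫ s in sphere (0 : ℂ) 1, φ (z + t • s) ∂μH[1]) * log |t ^ 2 - a ^ 2| =
      ∫ x, φ x * log |‖x - z‖ ^ 2 - a ^ 2| := by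
  have hzero : ∀ r θ : ℝ, 2 * R < r → φ (z + circleMap 0 r θ) = 0 := by
    intro r θ hr
    by_contra hne
    have h1 : ‖z + circleMap 0 r θ‖ < R := by
      simpa using hs (subset_tsupport φ hne)
    have h2 : ‖circleMap 0 r θ‖ ≤ ‖z + circleMap 0 r θ‖ + ‖z‖ := by
      simpa using norm_sub_le (z + circleMap 0 r θ) z
    have h3 : ‖circleMap 0 r θ‖ = r := by
      simp [abs_of_pos (show 0 < r by linarith)]
    linarith
  have hcont : Continuous fun p : ℝ × ℝ => p.1 * φ (z + circleMap 0 p.1 p.2) := by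
    unfold circleMap
    fun_prop
  obtain ⟨C, hC⟩ := hφ.bounded_above_of_compact_support hc
  have hint0 : IntegrableOn (fun p : ℝ × ℝ =>
      (p.1 * φ (z + circleMap 0 p.1 p.2)) * log |p.1 ^ 2 - a ^ 2|)
      (Set.Ioc 0 (2 * R) ×ˢ Set.Ioo (-π) π) := by
    have h1 : Integrable (fun p : ℝ × ℝ => log |p.1 ^ 2 - a ^ 2|)
        (volume.restrict (Set.Ioc 0 (2 * R) ×ˢ Set.Ioo (-π) π)) := by
      rw [Measure.volume_eq_prod, ← Measure.prod_restrict]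
      exact (integrableOn_log_abs_sq_sub_sq a 0 (2 * R)).comp_fst _
    refine Integrable.bdd_mul (c := 2 * R * C) h1 hcont.aestronglyMeasurable ?_
    filter_upwards [ae_restrict_mem (measurableSet_Ioc.prod measurableSet_Ioo)] with p hp
    rw [norm_mul]
    have := hp.1
    gcongr
    · rw [norm_of_nonneg this.1.le]; exact this.2
    · exact hC _
  have hint : IntegrableOn (fun p : ℝ × ℝ =>
      (p.1 * φ (z + circleMap 0 p.1 p.2)) * log |p.1 ^ 2 - a ^ 2|)
      (Set.Ioi 0 ×ˢ Set.Ioo (-π) π) := by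
    refine hint0.of_forall_sdiff_eq_zero (measurableSet_Ioi.prod measurableSet_Ioo) ?_
    rintro ⟨r, θ⟩ ⟨⟨hr, hθ⟩, hn⟩
    have : 2 * R < r := by
      by_contra hle
      exact hn ⟨⟨hr, not_lt.1 hle⟩, hθ⟩
    simp [hzero r θ this]
  calc _ = ∫ t in Set.Ioc 0 (2 * R), ∫ θ in Set.Ioo (-π) π,
        (t * φ (z + circleMap 0 t θ)) * log |t ^ 2 - a ^ 2| := by
        rw [intervalIntegral.integral_of_le (by positivity)]
        refine integral_congr_ae (Filter.Eventually.of_forall fun t => ?_)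
        have hm : StronglyMeasurable fun s : ℂ => φ (z + t • s) :=
          (by fun_prop : Continuous fun s : ℂ => φ (z + t • s)).stronglyMeasurable
        have hsm : ∀ θ, t • circleMap 0 1 θ = circleMap 0 t θ := by
          intro θ; simp [circleMap]
        beta_reduce
        rw [setIntegral_hausdorffMeasure_circle one_pos (-π) hm, integral_mul_const,
          integral_const_mul, one_mul, show -π + 2 * π = π by ring, integral_Ioc_eq_integral_Ioo]
        simp only [hsm]
    _ = ∫ t in Set.Ioi 0, ∫ θ in Set.Ioo (-π) π,
        (t * φ (z + circleMap 0 t θ)) * log |t ^ 2 - a ^ 2| := by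
        refine (setIntegral_eq_of_subset_of_forall_sdiff_eq_zero measurableSet_Ioi
          Set.Ioc_subset_Ioi_self ?_).symm
        rintro t ⟨ht, hn⟩
        have : 2 * R < t := by
          by_contra hle
          exact hn ⟨ht, not_lt.1 hle⟩
        simp [hzero t _ this]
    _ = ∫ p in Set.Ioi 0 ×ˢ Set.Ioo (-π) π,
        (p.1 * φ (z + circleMap 0 p.1 p.2)) * log |p.1 ^ 2 - a ^ 2| := by
        rw [Measure.volume_eq_prod] at hint ⊢
        exact (setIntegral_prod _ hint).symm
    _ = ∫ x, φ (x + z) * log |‖x‖ ^ 2 - a ^ 2| := by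
        rw [← Complex.integral_comp_polarCoord_symm]
        refine setIntegral_congr_fun (measurableSet_Ioi.prod measurableSet_Ioo) ?_
        rintro ⟨r, θ⟩ ⟨hr, -⟩
        have h1 : Complex.polarCoord.symm (r, θ) = circleMap 0 r θ := by
          simp [Complex.polarCoord_symm_apply, circleMap, Complex.exp_mul_I]
        simp only [h1, smul_eq_mul, add_comm z, norm_circleMap_zero, sq_abs]
        ring
    _ = ∫ x, φ x * log |‖x - z‖ ^ 2 - a ^ 2| := by
        rw [← integral_sub_right_eq_self _ z]
        simp

theorem abs_log_abs_le {M u : ℝ} (hM : |u| ≤ M) (hM1 : 1 ≤ M) :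
    |(log |u|)| ≤ 2 * log M - log |u| := by
  have h0 := log_nonneg hM1
  have h1 : log |u| ≤ log M := by
    rcases eq_or_ne u 0 with rfl | hu
    · simpa using h0
    · exact log_le_log (abs_pos.2 hu) hM
  rw [abs_le]
  constructor <;> linarith

theorem integrable_prod_mul_log_norm_sq_sub {R : ℝ} (hR : 0 < R) {φ : ℂ → ℝ}
    (hφ : Continuous φ) (hc : HasCompactSupport φ) (hs : tsupport φ ⊆ ball 0 R) {w : ℂ}
    (hw : ‖w‖ < R) :
    Integrable (Function.uncurry fun (x : ℂ) (θ : ℝ) =>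
        φ x * log |‖x - circleMap 0 R θ‖ ^ 2 - ‖w - circleMap 0 R θ‖ ^ 2|)
      (volume.prod (volume.restrict (Set.Ioc 0 (2 * π)))) := by
  have hmeas : Measurable (Function.uncurry fun (x : ℂ) (θ : ℝ) =>
      φ x * log |‖x - circleMap 0 R θ‖ ^ 2 - ‖w - circleMap 0 R θ‖ ^ 2|) := by
    have h1 : Measurable fun p : ℂ × ℝ =>
        |‖p.1 - circleMap 0 R p.2‖ ^ 2 - ‖w - circleMap 0 R p.2‖ ^ 2| :=
      (by unfold circleMap; fun_prop : Continuous _).measurable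
    exact (hφ.measurable.comp measurable_fst).mul (measurable_log.comp h1)
  have hsupp : ∀ x, φ x ≠ 0 → ‖x‖ < R := fun x hx => by
    simpa using hs (subset_tsupport φ hx)
  set M := max 1 ((2 * R) ^ 2) with hM
  have hbound : ∀ x θ, ‖x‖ < R →
      |‖x - circleMap 0 R θ‖ ^ 2 - ‖w - circleMap 0 R θ‖ ^ 2| ≤ M := by
    intro x θ hx
    have h1 : ∀ y : ℂ, ‖y‖ < R → ‖y - circleMap 0 R θ‖ ^ 2 ≤ (2 * R) ^ 2 := by
      intro y hy
      have := norm_sub_le y (circleMap 0 R θ)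
      rw [norm_circleMap_zero, abs_of_pos hR] at this
      gcongr
      linarith
    refine le_trans ?_ (le_max_right _ _)
    rw [abs_le]
    have := h1 x hx
    have := h1 w hw
    have := sq_nonneg ‖x - circleMap 0 R θ‖
    have := sq_nonneg ‖w - circleMap 0 R θ‖
    constructor <;> linarith
  have hae : ∀ᵐ x : ℂ, x ≠ w := Measure.ae_ne volume w
  rw [integrable_prod_iff hmeas.aestronglyMeasurable]
  constructor
  · filter_upwards [hae] with x hx
    by_cases h0 : φ x = 0
    · simp [h0]
    · exact Integrable.const_mul (integral_log_norm_sq_sub_norm_sq hR (hsupp x h0) hw hx).1 (φ x)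
  · have hdom : Integrable fun x : ℂ =>
        (4 * π * log M - 2 * π * log R) * |φ x| - 2 * π * (|φ x| * log ‖x - w‖) := by
      refine Integrable.sub ?_ ?_
      · exact (hφ.integrable_of_hasCompactSupport hc).abs.const_mul _
      · refine Integrable.const_mul ?_ _
        exact integrable_mul_log_norm_sub hφ.abs (hc.comp_left abs_zero) w
    refine hdom.mono' hmeas.norm.stronglyMeasurable.integral_prod_right'.aestronglyMeasurable ?_
    filter_upwards [hae] with x hx
    by_cases h0 : φ x = 0
    · simp [h0]
    have hxR := hsupp x h0
    obtain ⟨hI, hv⟩ := integral_log_norm_sq_sub_norm_sq hR hxR hw hx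
    rw [norm_of_nonneg (integral_nonneg fun _ => norm_nonneg _)]
    simp only [Function.uncurry_apply_pair, norm_mul, integral_const_mul, Real.norm_eq_abs]
    have hle : ∫ θ in Set.Ioc 0 (2 * π),
        |(log |‖x - circleMap 0 R θ‖ ^ 2 - ‖w - circleMap 0 R θ‖ ^ 2|)| ≤
        4 * π * log M - 2 * π * log (R * ‖x - w‖) := by
      calc _ ≤ ∫ θ in Set.Ioc 0 (2 * π), (2 * log M -
            log |‖x - circleMap 0 R θ‖ ^ 2 - ‖w - circleMap 0 R θ‖ ^ 2|) :=
            integral_mono hI.abs ((integrable_const _).sub hI)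
              fun θ => abs_log_abs_le (hbound x θ hxR) (le_max_left _ _)
        _ = _ := by
            rw [integral_sub (integrable_const _) hI, hv]
            simp [Real.pi_pos.le]
            ring
    rw [log_mul hR.ne' (norm_ne_zero_iff.2 (sub_ne_zero.2 hx))] at hle
    calc _ ≤ |φ x| * (4 * π * log M - 2 * π * (log R + log ‖x - w‖)) := by gcongr
      _ = _ := by ring

theorem backprojection_eq_log_potential {R : ℝ} (hR : 0 < R) {φ : ℂ → ℝ}
    (hφ : Continuous φ) (hc : HasCompactSupport φ) (hs : tsupport φ ⊆ ball 0 R) {w : ℂ}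
    (hw : ‖w‖ < R) :
    ∫ z in sphere (0 : ℂ) R, (∫ t in (0 : ℝ)..(2 * R),
      (t * ∫ s in sphere (0 : ℂ) 1, φ (z + t • s) ∂μH[1]) * log |t ^ 2 - ‖w - z‖ ^ 2|) ∂μH[1] =
      2 * π * R * (log R * (∫ x, φ x) + ∫ x, φ x * log ‖x - w‖) := by
  have hsm : StronglyMeasurable fun z : ℂ =>
      ∫ x, φ x * log |‖x - z‖ ^ 2 - ‖w - z‖ ^ 2| := by
    refine StronglyMeasurable.integral_prod_right (f := fun z x =>
      φ x * log |‖x - z‖ ^ 2 - ‖w - z‖ ^ 2|) (Measurable.stronglyMeasurable ?_)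
    have h1 : Measurable fun p : ℂ × ℂ => |‖p.2 - p.1‖ ^ 2 - ‖w - p.1‖ ^ 2| :=
      (by fun_prop : Continuous _).measurable
    exact (hφ.measurable.comp measurable_snd).mul (measurable_log.comp h1)
  rw [setIntegral_congr_fun isClosed_sphere.measurableSet fun z hz =>
      integral_mul_log_norm_sq_sub_eq_integral_circle hR hφ hc hs (by simpa using hz) ‖w - z‖,
    setIntegral_hausdorffMeasure_circle hR 0 hsm, zero_add,
    ← integral_integral_swap (integrable_prod_mul_log_norm_sq_sub hR hφ hc hs hw)]
  have hinner : ∀ᵐ x : ℂ, ∫ θ in Set.Ioc 0 (2 * π),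
      φ x * log |‖x - circleMap 0 R θ‖ ^ 2 - ‖w - circleMap 0 R θ‖ ^ 2| =
      2 * π * (log R * φ x + φ x * log ‖x - w‖) := by
    filter_upwards [Measure.ae_ne volume w] with x hx
    by_cases h0 : φ x = 0
    · simp [h0]
    rw [integral_const_mul, (integral_log_norm_sq_sub_norm_sq hR
      (by simpa using hs (subset_tsupport φ h0)) hw hx).2,
      log_mul hR.ne' (norm_ne_zero_iff.2 (sub_ne_zero.2 hx))]
    ring
  rw [integral_congr_ae hinner, integral_const_mul,
    integral_add ((hφ.integrable_of_hasCompactSupport hc).const_mul _)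
      (integrable_mul_log_norm_sub hφ hc w), integral_const_mul]
  ring

theorem setIntegral_sphere_hausdorffMeasure_comp
    (e : ℂ ≃ₗᵢ[ℝ] EuclideanSpace ℝ (Fin 2)) (r : ℝ) (h : EuclideanSpace ℝ (Fin 2) → ℝ) :
    ∫ z in sphere (0 : EuclideanSpace ℝ (Fin 2)) r, h z ∂μH[1] =
      ∫ z in sphere (0 : ℂ) r, h (e z) ∂μH[1] := by
  have h1 := (e.toIsometryEquiv.measurePreserving_hausdorffMeasure 1).setIntegral_preimage_emb
    e.toHomeomorph.measurableEmbedding h (sphere 0 r)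
  rw [← h1]
  have h2 : e.toIsometryEquiv ⁻¹' sphere 0 r = sphere 0 r := by
    ext z; simp
  rw [h2]
  rfl

theorem deriv_deriv_eq_of_eventuallyEq_const_mul_add {F L : ℝ → ℝ} {a c x : ℝ}
    (h : F =ᶠ[nhds x] fun t => a * (c + L t)) : deriv (deriv F) x = a * deriv (deriv L) x := by
  rw [h.deriv.deriv_eq]
  simp only [deriv_const_mul_field', deriv_const_add', deriv_const_mul_field]

/-- The 2D filtered backprojection inversion formula of Finch–Haltmeier–Rakesh
(Laplacian form): for `f` smooth supported in the open disk `B` of radius `R` and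
`g(z,t)` its integrals over circles of radius `t` centered at `z ∈ S = ∂B`,
`f(y) = (1/(4π²R)) Δ_y ∫_S ∫_0^{2R} g(z,t) log|t² - ‖y-z‖²| dt dl(z)`. -/
theorem finch_inversion_formula_2d_laplacian_form
    (R : ℝ) (hR : 0 < R)
    (f : EuclideanSpace ℝ (Fin 2) → ℝ)
    (hf_smooth : ContDiff ℝ (⊤ : ℕ∞) f)
    (hf_supp : tsupport f ⊆ ball (0 : EuclideanSpace ℝ (Fin 2)) R)
    (g : EuclideanSpace ℝ (Fin 2) → ℝ → ℝ)
    (hg : ∀ z t, g z t =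
      t * ∫ s in sphere (0 : EuclideanSpace ℝ (Fin 2)) 1, f (z + t • s) ∂(μH[1])) :
    ∀ y ∈ ball (0 : EuclideanSpace ℝ (Fin 2)) R,
      f y = (1 / (4 * π ^ 2 * R)) *
        euclideanLaplacian
          (fun y' => ∫ z in sphere (0 : EuclideanSpace ℝ (Fin 2)) R,
            (∫ t in (0 : ℝ)..(2 * R), g z t * Real.log |t ^ 2 - ‖y' - z‖ ^ 2|) ∂(μH[1])) y := by
  intro y hy
  set e : ℂ ≃ₗᵢ[ℝ] EuclideanSpace ℝ (Fin 2) := Complex.orthonormalBasisOneI.repr with he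
  set φ : ℂ → ℝ := fun x => f (e x) with hφdef
  have hφ2 : ContDiff ℝ 2 φ :=
    (contDiff_infty.1 hf_smooth 2).comp e.toContinuousLinearEquiv.contDiff
  have hcf : HasCompactSupport f :=
    isCompact_of_isClosed_isBounded (isClosed_tsupport f) (isBounded_ball.subset hf_supp)
  have hc : HasCompactSupport φ := hcf.comp_homeomorph e.toHomeomorph
  have hs : tsupport φ ⊆ ball 0 R := by
    intro x hx
    have h1 : e x ∈ tsupport f := tsupport_comp_subset_preimage f e.continuous hx
    simpa using hf_supp h1
  have hF : ∀ w : ℂ, ‖w‖ < R →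
      (∫ z in sphere (0 : EuclideanSpace ℝ (Fin 2)) R,
        (∫ t in (0 : ℝ)..(2 * R), g z t * Real.log |t ^ 2 - ‖e w - z‖ ^ 2|) ∂(μH[1])) =
      2 * π * R * (log R * (∫ x, φ x) + ∫ x, φ x * log ‖x - w‖) := by
    intro w hw
    rw [← backprojection_eq_log_potential hR hφ2.continuous hc hs hw,
      setIntegral_sphere_hausdorffMeasure_comp e]
    simp only [hg, setIntegral_sphere_hausdorffMeasure_comp e, hφdef, map_add, map_smul,
      ← map_sub, LinearIsometryEquiv.norm_map]
  obtain ⟨w, rfl⟩ := e.surjective y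
  have hw : ‖w‖ < R := by simpa using hy
  have hdir : ∀ (i : Fin 2) (v : ℂ), e v = EuclideanSpace.single i 1 →
      deriv (deriv fun t : ℝ => ∫ z in sphere (0 : EuclideanSpace ℝ (Fin 2)) R,
        (∫ t' in (0 : ℝ)..(2 * R), g z t' *
          Real.log |t' ^ 2 - ‖e w + t • EuclideanSpace.single i 1 - z‖ ^ 2|) ∂(μH[1])) 0 =
      2 * π * R * deriv (deriv fun t : ℝ => ∫ x, φ x * log ‖x - (w + t • v)‖) 0 := by
    intro i v hv
    refine deriv_deriv_eq_of_eventuallyEq_const_mul_add (c := log R * ∫ x, φ x) ?_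
    have hcont : Continuous fun t : ℝ => ‖w + t • v‖ := by fun_prop
    filter_upwards [hcont.continuousAt.eventually_lt (continuousAt_const (y := R))
      (by simpa using hw : ‖w + (0 : ℝ) • v‖ < R)] with t ht
    rw [← hF _ ht, map_add, map_smul, hv]
  have he0 : e 1 = EuclideanSpace.single 0 1 := by
    ext i; fin_cases i <;> simp [he]
  have he1 : e Complex.I = EuclideanSpace.single 1 1 := by
    ext i; fin_cases i <;> simp [he]
  rw [euclideanLaplacian, Fin.sum_univ_two, hdir 0 1 he0, hdir 1 Complex.I he1, ← mul_add,
    laplacian_log_potential hφ2 hc w]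
  field_simp
  ring
end
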